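/- arXiv:1607.07591 — 9 statements merged into one kernel-verified Lean document; each statement's English description precedes it below -/
import Mathlib

section
/- Let 0 < a and γ > 0, and let α be a differentiable function with values in (0,1). Define x(t) = (ln(t/a))^γ for t ≥ a (with x(a)=0). Then for every t > a, the left Caputo–Hadamard fractional derivative of variable order type 2 of x at t equals Γ(γ+1)/Γ(γ+1−α(t)) · (ln(t/a))^{γ−α(t)} − (t·α'(t)·Γ(γ+1)/Γ(γ+2−α(t))) · (ln(t/a))^{γ+1−α(t)} · [ln(ln(t/a)) + ψ(1−α(t)) − ψ(γ+2−α(t))]. -/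
/-- The digamma function `ψ(x) = Γ'(x)/Γ(x)`. -/
noncomputable def digamma (x : ℝ) : ℝ := deriv Real.Gamma x / Real.Gamma x

/-- The left Caputo–Hadamard fractional derivative of variable order `α(t)`, type 2. -/
noncomputable def CHD2 (a : ℝ) (α x : ℝ → ℝ) (t : ℝ) : ℝ :=
  (t / Real.Gamma (1 - α t)) *
    deriv (fun s : ℝ => ∫ τ in a..s, (Real.log (s / τ)) ^ (-(α s)) * (x τ - x a) / τ) t

theorem aux_beta (L u v : ℝ) (hL : 0 < L) (hu : 0 < u) (hv : 0 < v) :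
    ∫ x in (0:ℝ)..L, x ^ (u - 1) * (L - x) ^ (v - 1)
      = L ^ (u + v - 1) * (Real.Gamma u * Real.Gamma v / Real.Gamma (u + v)) := by
  have h := Complex.betaIntegral_scaled (u : ℂ) (v : ℂ) hL
  rw [Complex.betaIntegral_eq_Gamma_mul_div _ _ (by simpa using hu) (by simpa using hv)] at h
  apply Complex.ofReal_injective
  rw [← intervalIntegral.integral_ofReal]
  push_cast [Complex.ofReal_cpow hL.le, ← Complex.Gamma_ofReal]
  rw [← h]
  apply intervalIntegral.integral_congr
  intro x hx
  rw [Set.uIcc_of_le hL.le] at hx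
  have h2 : 0 ≤ L - x := sub_nonneg.2 hx.2
  push_cast [Complex.ofReal_cpow hx.1, Complex.ofReal_cpow h2]
  rfl

theorem aux_log (a t : ℝ) (ha : 0 < a) (h0 : 0 < t) :
    HasDerivAt (fun τ => Real.log (τ / a)) (1 / t) t := by
  have h := ((hasDerivAt_id' t).div_const a).log (div_pos h0 ha).ne'
  refine h.congr_deriv ?_
  field_simp

theorem aux_int (a γ b s : ℝ) (ha : 0 < a) (hγ : 0 < γ) (hb : b < 1) (hs : a < s) :
    ∫ τ in a..s, (Real.log (s / τ)) ^ (-b) *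
        ((Real.log (τ / a)) ^ γ - (Real.log (a / a)) ^ γ) / τ
      = (Real.log (s / a)) ^ (γ + 1 - b) *
        (Real.Gamma (γ + 1) * Real.Gamma (1 - b) / Real.Gamma (γ + 2 - b)) := by
  have hL : 0 < Real.log (s / a) := Real.log_pos ((one_lt_div ha).2 hs)
  have h := aux_beta (Real.log (s / a)) (γ + 1) (1 - b) hL (by linarith) (by linarith)
  rw [show γ + 1 + (1 - b) - 1 = γ + 1 - b by ring,
    show γ + 1 + (1 - b) = γ + 2 - b by ring] at h
  rw [← h, intervalIntegral.integral_of_le hs.le, intervalIntegral.integral_of_le hL.le]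
  have him : (fun τ => Real.log (τ / a)) '' Set.Ioc a s = Set.Ioc 0 (Real.log (s / a)) := by
    ext y
    constructor
    · rintro ⟨τ, ⟨h1, h2⟩, rfl⟩
      have : 0 < τ := ha.trans h1
      exact ⟨Real.log_pos ((one_lt_div ha).2 h1),
        Real.log_le_log (by positivity) (by gcongr)⟩
    · rintro ⟨h1, h2⟩
      refine ⟨a * Real.exp y, ⟨?_, ?_⟩, ?_⟩
      · nlinarith [Real.add_one_lt_exp h1.ne']
      · rw [Real.le_log_iff_exp_le (by have := ha.trans hs; positivity), le_div_iff₀ ha] at h2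
        linarith
      · simp [ha.ne']
  rw [← him, MeasureTheory.integral_image_eq_integral_abs_deriv_smul (f' := fun τ => 1 / τ)
    measurableSet_Ioc]
  · apply MeasureTheory.setIntegral_congr_fun measurableSet_Ioc
    rintro τ ⟨h1, h2⟩
    have h0 : 0 < τ := ha.trans h1
    have h3 : 0 < s := ha.trans hs
    have : Real.log (s / τ) = Real.log (s / a) - Real.log (τ / a) := by
      rw [Real.log_div h3.ne' h0.ne', Real.log_div h3.ne' ha.ne', Real.log_div h0.ne' ha.ne']
      ring
    simp only [this, div_self ha.ne', Real.log_one, Real.zero_rpow hγ.ne', smul_eq_mul,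
      abs_of_pos (one_div_pos.2 h0)]
    rw [show γ + 1 - 1 = γ by ring, show 1 - b - 1 = -b by ring]
    ring
  · rintro τ ⟨h1, h2⟩
    have h0 : 0 < τ := ha.trans h1
    exact (aux_log a τ ha h0).hasDerivWithinAt
  · rintro x ⟨h1, _⟩ y ⟨h2, _⟩ hxy
    have hx : 0 < x := ha.trans h1
    have hy : 0 < y := ha.trans h2
    have := Real.log_injOn_pos (Set.mem_Ioi.2 (div_pos hx ha)) (Set.mem_Ioi.2 (div_pos hy ha)) hxy
    field_simp at this
    exact this

theorem aux_Gamma (x : ℝ) (hx : 0 < x) : HasDerivAt Real.Gamma (deriv Real.Gamma x) x := by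
  apply DifferentiableAt.hasDerivAt
  apply Real.differentiableAt_Gamma
  intro m
  have : (0:ℝ) ≤ m := by positivity
  linarith

/-- the value of the left Caputo–Hadamard derivative of variable order,
type 2, of `x(t) = (ln(t/a))^γ`. -/
theorem caputoHadamard_left_type2_log_rpow
    (a γ : ℝ) (ha : 0 < a) (hγ : 0 < γ) (α : ℝ → ℝ)
    (hα : ∀ s, α s ∈ Set.Ioo (0 : ℝ) 1) (hαd : Differentiable ℝ α)
    (t : ℝ) (ht : a < t) :
    CHD2 a α (fun s : ℝ => (Real.log (s / a)) ^ γ) t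
      = Real.Gamma (γ + 1) / Real.Gamma (γ + 1 - α t) *
          (Real.log (t / a)) ^ (γ - α t)
        - (t * deriv α t * Real.Gamma (γ + 1) / Real.Gamma (γ + 2 - α t)) *
            (Real.log (t / a)) ^ (γ + 1 - α t) *
            (Real.log (Real.log (t / a)) + digamma (1 - α t)
              - digamma (γ + 2 - α t)) := by
  unfold CHD2
  have hev : (fun s : ℝ => ∫ τ in a..s, (Real.log (s / τ)) ^ (-(α s)) *
        ((fun s : ℝ => (Real.log (s / a)) ^ γ) τ - (fun s : ℝ => (Real.log (s / a)) ^ γ) a) / τ)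
      =ᶠ[nhds t] fun s => (Real.log (s / a)) ^ (γ + 1 - α s) *
        (Real.Gamma (γ + 1) * Real.Gamma (1 - α s) / Real.Gamma (γ + 2 - α s)) := by
    filter_upwards [lt_mem_nhds ht] with s hs
    exact aux_int a γ (α s) s ha hγ (hα s).2 hs
  rw [hev.deriv_eq]
  have hL : 0 < Real.log (t / a) := Real.log_pos ((one_lt_div ha).2 ht)
  have h0 : 0 < t := ha.trans ht
  obtain ⟨hα0, hα1⟩ := hα t
  have dα := (hαd t).hasDerivAt
  have dL : HasDerivAt (fun τ => Real.log (τ / a)) (1 / t) t := aux_log a t ha h0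
  have dP := dL.rpow (dα.const_sub (γ + 1)) hL
  have dG1 := (aux_Gamma (1 - α t) (by linarith)).comp t (dα.const_sub 1)
  have dG2 := (aux_Gamma (γ + 2 - α t) (by linarith)).comp t (dα.const_sub (γ + 2))
  have p1 : 0 < Real.Gamma (1 - α t) := Real.Gamma_pos_of_pos (by linarith)
  have p2 : 0 < Real.Gamma (γ + 1 - α t) := Real.Gamma_pos_of_pos (by linarith)
  have p3 : Real.Gamma (γ + 2 - α t) = (γ + 1 - α t) * Real.Gamma (γ + 1 - α t) := by
    rw [← Real.Gamma_add_one (by linarith)]; ring_nf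
  have p4 : 0 < γ + 1 - α t := by linarith
  have p5 : 0 < Real.Gamma (γ + 2 - α t) := Real.Gamma_pos_of_pos (by linarith)
  have D := dP.mul ((dG1.const_mul (Real.Gamma (γ + 1))).div dG2 p5.ne')
  refine (congrArg _ (HasDerivAt.deriv D)).trans ?_
  simp only [Pi.div_apply, Function.comp_apply, digamma]
  rw [show γ + 1 - α t - 1 = γ - α t by ring]
  generalize deriv Real.Gamma (1 - α t) = A
  generalize deriv Real.Gamma (γ + 2 - α t) = B
  generalize Real.log (t / a) ^ (γ - α t) = X
  generalize Real.log (t / a) ^ (γ + 1 - α t) = Y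
  rw [p3]
  field_simp
  ring
end

section
/- Let 0 < a < b and γ > 0, and let α be a differentiable function with values in (0,1). Define x(t) = (ln(b/t))^γ for a ≤ t ≤ b (with x(b)=0). Then for every t with a ≤ t < b, the right Caputo–Hadamard fractional derivative of variable order type 2 of x at t equals Γ(γ+1)/Γ(γ+1−α(t)) · (ln(b/t))^{γ−α(t)} + (t·α'(t)·Γ(γ+1)/Γ(γ+2−α(t))) · (ln(b/t))^{γ+1−α(t)} · [ln(ln(b/t)) + ψ(1−α(t)) − ψ(γ+2−α(t))]. -/
theorem beta_scaled_real (p γ L : ℝ) (hp : p < 1) (hγ : 0 < γ) (hL : 0 < L) :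
    ∫ u in (0:ℝ)..L, u ^ (-p) * (L - u) ^ γ
      = Real.Gamma (1 - p) * Real.Gamma (γ + 1) / Real.Gamma (γ + 2 - p) * L ^ (γ + 1 - p) := by
  have h := Complex.betaIntegral_scaled ((1 - p : ℝ) : ℂ) ((γ + 1 : ℝ) : ℂ) hL
  rw [Complex.betaIntegral_eq_Gamma_mul_div _ _ (by simpa using hp) (by simp; linarith)] at h
  rw [← Complex.ofReal_inj, ← intervalIntegral.integral_ofReal]
  have e : ∫ u in (0:ℝ)..L, ((u ^ (-p) * (L - u) ^ γ : ℝ) : ℂ)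
      = ∫ x in (0:ℝ)..L, (x : ℂ) ^ (((1 - p : ℝ) : ℂ) - 1) *
          ((L : ℂ) - x) ^ (((γ + 1 : ℝ) : ℂ) - 1) := by
    apply intervalIntegral.integral_congr
    intro u hu
    rw [Set.uIcc_of_le hL.le] at hu
    have h1 : ((1 - p : ℝ) : ℂ) - 1 = ((-p : ℝ) : ℂ) := by push_cast; ring
    have h2 : ((γ + 1 : ℝ) : ℂ) - 1 = (γ : ℂ) := by push_cast; ring
    simp only [h1, h2]
    rw [Complex.ofReal_mul, Complex.ofReal_cpow hu.1, Complex.ofReal_cpow (by linarith [hu.2]),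
      Complex.ofReal_sub]
  rw [e, h, ← Complex.ofReal_add, Complex.Gamma_ofReal, Complex.Gamma_ofReal, Complex.Gamma_ofReal]
  have h3 : (((1 - p + (γ + 1) : ℝ) : ℂ) - 1) = ((γ + 1 - p : ℝ) : ℂ) := by push_cast; ring
  have h4 : 1 - p + (γ + 1) = γ + 2 - p := by ring
  rw [h3, h4, ← Complex.ofReal_cpow hL.le]
  push_cast
  ring

theorem integral_eval (b γ p s : ℝ) (hs : 0 < s) (hsb : s < b) (hp : p < 1) (hγ : 0 < γ) :
    ∫ τ in s..b, (Real.log (τ / s)) ^ (-p) *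
        ((Real.log (b / τ)) ^ γ - (Real.log (b / b)) ^ γ) / τ
      = Real.Gamma (1 - p) * Real.Gamma (γ + 1) / Real.Gamma (γ + 2 - p) *
        (Real.log (b / s)) ^ (γ + 1 - p) := by
  have hb : 0 < b := hs.trans hsb
  have hL : 0 < Real.log (b / s) := Real.log_pos ((one_lt_div hs).2 hsb)
  rw [← beta_scaled_real p γ _ hp hγ hL, intervalIntegral.integral_of_le hsb.le,
    intervalIntegral.integral_of_le hL.le]
  have him : (fun u : ℝ => s * Real.exp u) '' Set.Ioc 0 (Real.log (b / s)) = Set.Ioc s b := by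
    ext y
    constructor
    · rintro ⟨u, ⟨h0, h1⟩, rfl⟩
      rw [Real.le_log_iff_exp_le (by positivity), le_div_iff₀ hs] at h1
      have := Real.one_lt_exp_iff.2 h0
      constructor
      · show s < s * Real.exp u
        nlinarith
      · show s * Real.exp u ≤ b
        linarith
    · rintro ⟨h0, h1⟩
      have hy : 0 < y := hs.trans h0
      refine ⟨Real.log (y / s), ⟨Real.log_pos ((one_lt_div hs).2 h0),
        Real.log_le_log (by positivity) (by gcongr)⟩, ?_⟩
      show s * Real.exp (Real.log (y / s)) = y
      rw [Real.exp_log (by positivity)]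
      field_simp
  rw [← him, MeasureTheory.integral_image_eq_integral_abs_deriv_smul
    (f' := fun u => s * Real.exp u) measurableSet_Ioc
    (fun u _ => ((Real.hasDerivAt_exp u).const_mul s).hasDerivWithinAt)
    (fun u _ v _ h => Real.exp_injective (mul_left_cancel₀ hs.ne' h))]
  apply MeasureTheory.setIntegral_congr_fun measurableSet_Ioc
  intro u _
  have hpos : 0 < s * Real.exp u := by positivity
  have e1 : s * Real.exp u / s = Real.exp u := by field_simp
  have e2 : Real.log (b / (s * Real.exp u)) = Real.log (b / s) - u := by
    rw [← div_div, Real.log_div (by positivity) (by positivity), Real.log_exp]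
  simp only [smul_eq_mul, abs_of_pos hpos, e1, e2, Real.log_exp, div_self hb.ne', Real.log_one,
    Real.zero_rpow hγ.ne', sub_zero]
  field_simp


/-- The right Caputo–Hadamard fractional derivative of variable order `α(t)`, type 2. -/
noncomputable def CHD2r (b : ℝ) (α x : ℝ → ℝ) (t : ℝ) : ℝ :=
  (-t / Real.Gamma (1 - α t)) *
    deriv (fun s : ℝ => ∫ τ in s..b, (Real.log (τ / s)) ^ (-(α s)) * (x τ - x b) / τ) t

/-- the value of the right Caputo–Hadamard derivative of variable order,
type 2, of `x(t) = (ln(b/t))^γ`. -/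
theorem caputoHadamard_right_type2_log_rpow
    (a b γ : ℝ) (ha : 0 < a) (hab : a < b) (hγ : 0 < γ) (α : ℝ → ℝ)
    (hα : ∀ s, α s ∈ Set.Ioo (0 : ℝ) 1) (hαd : Differentiable ℝ α)
    (t : ℝ) (ht : t ∈ Set.Ico a b) :
    CHD2r b α (fun s : ℝ => (Real.log (b / s)) ^ γ) t
      = Real.Gamma (γ + 1) / Real.Gamma (γ + 1 - α t) *
          (Real.log (b / t)) ^ (γ - α t)
        + (t * deriv α t * Real.Gamma (γ + 1) / Real.Gamma (γ + 2 - α t)) *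
            (Real.log (b / t)) ^ (γ + 1 - α t) *
            (Real.log (Real.log (b / t)) + digamma (1 - α t)
              - digamma (γ + 2 - α t)) := by
  obtain ⟨hat, htb⟩ := ht
  have ht0 : 0 < t := ha.trans_le hat
  have hb : 0 < b := ht0.trans htb
  obtain ⟨hα0, hα1⟩ := hα t
  have hL : 0 < Real.log (b / t) := Real.log_pos ((one_lt_div ht0).2 htb)
  unfold CHD2r digamma
  have hev : (fun s : ℝ => ∫ τ in s..b, (Real.log (τ / s)) ^ (-(α s)) *
      ((fun s : ℝ => (Real.log (b / s)) ^ γ) τ - (fun s : ℝ => (Real.log (b / s)) ^ γ) b) / τ)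
      =ᶠ[nhds t] fun s => Real.Gamma (1 - α s) * Real.Gamma (γ + 1) / Real.Gamma (γ + 2 - α s) *
        (Real.log (b / s)) ^ (γ + 1 - α s) := by
    filter_upwards [Ioo_mem_nhds ht0 htb] with s hs
    exact integral_eval b γ (α s) s hs.1 hs.2 (hα s).2 hγ
  rw [hev.deriv_eq]
  have hA := (hαd t).hasDerivAt
  have hG : ∀ y : ℝ, 0 < y → HasDerivAt Real.Gamma (deriv Real.Gamma y) y := fun y hy =>
    (Real.differentiableAt_Gamma (fun m => by
      have : (0:ℝ) ≤ m := Nat.cast_nonneg m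
      linarith)).hasDerivAt
  have h1 : HasDerivAt (fun s => Real.Gamma (1 - α s))
      (deriv Real.Gamma (1 - α t) * -deriv α t) t :=
    HasDerivAt.comp (h₂ := Real.Gamma) (h := fun s => 1 - α s) t (hG (1 - α t) (by linarith)) (hA.const_sub 1)
  have h2 : HasDerivAt (fun s => Real.Gamma (γ + 2 - α s))
      (deriv Real.Gamma (γ + 2 - α t) * -deriv α t) t :=
    HasDerivAt.comp (h₂ := Real.Gamma) (h := fun s => γ + 2 - α s) t
      (hG (γ + 2 - α t) (by linarith)) (hA.const_sub (γ + 2))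
  have p1 : 0 < Real.Gamma (1 - α t) := Real.Gamma_pos_of_pos (by linarith)
  have p2 : 0 < Real.Gamma (γ + 1 - α t) := Real.Gamma_pos_of_pos (by linarith)
  have p3 : 0 < γ + 1 - α t := by linarith
  have e2 : Real.Gamma (γ + 2 - α t) = (γ + 1 - α t) * Real.Gamma (γ + 1 - α t) := by
    rw [← Real.Gamma_add_one p3.ne']; congr 1; ring
  have p4 : 0 < Real.Gamma (γ + 2 - α t) := Real.Gamma_pos_of_pos (by linarith)
  have h3 : HasDerivAt (fun s => Real.log (b / s)) (-1 / t) t := by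
    have := (((hasDerivAt_id t).inv ht0.ne').const_mul b).log
      (by simp only [Pi.inv_apply, id]; positivity)
    convert this using 1
    · funext y
      simp only [Pi.inv_apply, id, div_eq_mul_inv]
    · show -1 / t = b * (-1 / t ^ 2) / (b * t⁻¹)
      field_simp
  have h4 := h3.rpow (hA.const_sub (γ + 1)) hL
  have h5 := (((h1.mul_const (Real.Gamma (γ + 1))).div h2 p4.ne').mul h4).deriv
  have h6 : deriv (fun s => Real.Gamma (1 - α s) * Real.Gamma (γ + 1) / Real.Gamma (γ + 2 - α s) *
        (Real.log (b / s)) ^ (γ + 1 - α s)) t = _ := h5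
  rw [h6]
  have e3 : γ + 1 - α t - 1 = γ - α t := by ring
  have e4 : Real.log (b / t) ^ (γ + 1 - α t)
      = Real.log (b / t) ^ (γ - α t) * Real.log (b / t) := by
    rw [← Real.rpow_add_one hL.ne']; congr 1; ring
  simp only [Pi.div_apply, e3, e4]
  generalize deriv Real.Gamma (γ + 2 - α t) = D2
  generalize deriv Real.Gamma (1 - α t) = D1
  rw [e2]
  generalize Real.log (b / t) ^ (γ - α t) = R
  field_simp
  ring
end

section
/- Let 0 < a < b, let α : [a,b] → (0,1) be differentiable, and let x : [a,b] → ℝ be continuously differentiable. Then for every t ∈ (a,b], (D₂x)(t) = (𝔻₁x)(t) + (t·α'(t)/Γ(2−α(t))) ∫_a^t (ln(t/τ))^{1−α(t)} x'(τ) [1/(1−α(t)) − ln(ln(t/τ))] dτ. -/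
/-- The left Caputo–Hadamard fractional derivative of variable order `α(t)`, type 1. -/
noncomputable def CHD1 (a : ℝ) (α x : ℝ → ℝ) (t : ℝ) : ℝ :=
  (1 / Real.Gamma (1 - α t)) * ∫ τ in a..t, (Real.log (t / τ)) ^ (-(α t)) * deriv x τ

noncomputable def WW (p0 l : ℝ) : ℝ := l ^ (p0 - 1) + 1 + l ^ 2

lemma WW_pow {p0 q l : ℝ} (hq : p0 ≤ q) (hq1 : q ≤ 1) (hl : 0 < l) :
    l ^ (q - 1) ≤ WW p0 l := by
  unfold WW
  have h0 : 0 ≤ l ^ (p0 - 1) := (Real.rpow_pos_of_pos hl _).le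
  rcases le_total l 1 with h | h
  · have := Real.rpow_le_rpow_of_exponent_ge hl h (show p0 - 1 ≤ q - 1 by linarith)
    nlinarith [sq_nonneg l]
  · have := Real.rpow_le_one_of_one_le_of_nonpos h (show q - 1 ≤ 0 by linarith)
    nlinarith [sq_nonneg l]

lemma WW_log {p0 q l : ℝ} (hq : p0 ≤ q) (hq1 : q ≤ 1) (hl : 0 < l) :
    l ^ q * |Real.log l| ≤ WW p0 l := by
  have hW := WW_pow hq hq1 hl
  have h0 : 0 ≤ l ^ (p0 - 1) := (Real.rpow_pos_of_pos hl _).le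
  have hlq : 0 ≤ l ^ q := (Real.rpow_pos_of_pos hl _).le
  rcases le_total l 1 with h | h
  · refine le_trans ?_ hW
    rw [Real.rpow_sub_one hl.ne', div_eq_mul_inv]
    apply mul_le_mul_of_nonneg_left _ hlq
    rw [abs_of_nonpos (Real.log_nonpos hl.le h), ← Real.log_inv]
    have := Real.log_le_sub_one_of_pos (inv_pos.2 hl)
    linarith
  · have h1 : l ^ q ≤ l := by
      simpa using Real.rpow_le_rpow_of_exponent_le h hq1
    have h2 : |Real.log l| ≤ l := by
      rw [abs_of_nonneg (Real.log_nonneg h)]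
      have := Real.log_le_sub_one_of_pos hl
      linarith
    have := mul_le_mul h1 h2 (abs_nonneg _) hl.le
    unfold WW
    nlinarith

lemma core_exp' {p0 q r l : ℝ} (hq : p0 ≤ q) (hq1 : q ≤ 1) (hl : 0 < l) :
    l ^ q - l ^ r ≤ WW p0 l * |q - r| := by
  have h1 : l ^ q - l ^ r ≤ l ^ q * (Real.log l * (q - r)) := by
    have e : l ^ r = l ^ q * Real.exp (Real.log l * (r - q)) := by
      rw [← Real.rpow_def_of_pos hl, ← Real.rpow_add hl]; congr 1; ring
    have := Real.add_one_le_exp (Real.log l * (r - q))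
    have hp := Real.rpow_pos_of_pos hl q
    rw [e]
    nlinarith
  have hp := Real.rpow_pos_of_pos hl q
  calc _ ≤ l ^ q * (Real.log l * (q - r)) := h1
    _ ≤ l ^ q * (|Real.log l| * |q - r|) := by
      apply mul_le_mul_of_nonneg_left _ hp.le
      rw [← abs_mul]; exact le_abs_self _
    _ = (l ^ q * |Real.log l|) * |q - r| := by ring
    _ ≤ _ := mul_le_mul_of_nonneg_right (WW_log hq hq1 hl) (abs_nonneg _)

lemma core_exp {p0 q r l : ℝ} (hq : p0 ≤ q) (hq1 : q ≤ 1) (hr : p0 ≤ r) (hr1 : r ≤ 1)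
    (hl : 0 < l) : |l ^ q - l ^ r| ≤ WW p0 l * |q - r| := by
  rw [abs_le']
  refine ⟨core_exp' hq hq1 hl, ?_⟩
  have := core_exp' (q := r) (r := q) hr hr1 hl
  rw [abs_sub_comm] at this
  linarith

lemma core_base {q w y : ℝ} (hq : 0 < q) (hq1 : q ≤ 1) (hw : 0 ≤ w) (hy : 0 < y) :
    |w ^ q - y ^ q| ≤ y ^ (q - 1) * |w - y| := by
  have ey : y ^ q = y ^ (q - 1) * y := by
    rw [Real.rpow_sub_one hy.ne']; field_simp
  rcases hw.eq_or_lt with rfl | hw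
  · rw [Real.zero_rpow hq.ne', zero_sub, zero_sub, abs_neg, abs_neg,
      abs_of_pos (Real.rpow_pos_of_pos hy _), abs_of_pos hy, ey]
  have ew : w ^ q = w ^ (q - 1) * w := by
    rw [Real.rpow_sub_one hw.ne']; field_simp
  rcases le_total w y with h | h
  · have h1 := Real.rpow_le_rpow_of_nonpos hw h (show q - 1 ≤ 0 by linarith)
    have h2 := Real.rpow_le_rpow hw.le h hq.le
    rw [abs_of_nonpos (by linarith), abs_of_nonpos (by linarith), ew, ey]
    nlinarith
  · have h1 := Real.rpow_le_rpow_of_nonpos hy h (show q - 1 ≤ 0 by linarith)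
    have h2 := Real.rpow_le_rpow hy.le h hq.le
    rw [abs_of_nonneg (by linarith), abs_of_nonneg (by linarith), ew, ey]
    nlinarith

lemma core {p0 q r y z : ℝ} (hp : 0 < p0) (hq : p0 ≤ q) (hq1 : q ≤ 1) (hr : p0 ≤ r)
    (hr1 : r ≤ 1) (hy : y ≠ 0) :
    |(max 0 z) ^ q - (max 0 y) ^ r| ≤ WW p0 |y| * (|z - y| + |q - r|) := by
  have hW0 : 0 ≤ WW p0 |y| :=
    (Real.rpow_pos_of_pos (abs_pos.2 hy) _).le.trans (WW_pow hq hq1 (abs_pos.2 hy))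
  rcases lt_or_gt_of_ne hy with h | h
  · rw [max_eq_left h.le, Real.zero_rpow (by linarith), sub_zero]
    have hW := WW_pow hq hq1 (abs_pos.2 hy)
    rcases le_or_gt z 0 with hz | hz
    · rw [max_eq_left hz, Real.zero_rpow (by linarith), abs_zero]
      positivity
    · rw [max_eq_right hz.le, abs_of_pos (Real.rpow_pos_of_pos hz _)]
      have hzy : 0 < z - y := by linarith
      have e : (z - y) ^ q = (z - y) ^ (q - 1) * (z - y) := by
        rw [Real.rpow_sub_one hzy.ne']; field_simp
      calc z ^ q ≤ (z - y) ^ q := Real.rpow_le_rpow hz.le (by linarith) (by linarith)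
        _ = (z - y) ^ (q - 1) * (z - y) := e
        _ ≤ WW p0 |y| * (z - y) := by
          apply mul_le_mul_of_nonneg_right _ hzy.le
          refine le_trans ?_ hW
          apply Real.rpow_le_rpow_of_nonpos (abs_pos.2 hy) _ (by linarith)
          rw [abs_of_neg h]; linarith
        _ ≤ _ := by
          apply mul_le_mul_of_nonneg_left _ hW0
          rw [abs_of_pos hzy]
          have := abs_nonneg (q - r)
          linarith
  · rw [max_eq_right h.le, abs_of_pos h]
    rw [abs_of_pos h] at hW0
    have h1 := core_base (w := max 0 z) (hp.trans_le hq) hq1 (le_max_left _ _) h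
    have h2 := core_exp hq hq1 hr hr1 h
    have h3 : |max 0 z - y| ≤ |z - y| := by
      have := abs_max_sub_max_le_abs z y 0
      rwa [max_comm z, max_eq_left h.le] at this
    have hW := WW_pow hq hq1 h
    calc _ ≤ |(max 0 z) ^ q - y ^ q| + |y ^ q - y ^ r| := abs_sub_le _ _ _
      _ ≤ WW p0 y * |z - y| + WW p0 y * |q - r| := by
        refine add_le_add (h1.trans ?_) h2
        exact mul_le_mul hW h3 (abs_nonneg _) hW0
      _ = _ := by ring

open MeasureTheory

lemma cont_logpow {s a p : ℝ} (ha : 0 < a) (hp : 0 < p) (has : a < s) :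
    ContinuousOn (fun τ => Real.log (s / τ) ^ p) (Set.uIcc a s) := by
  have : ContinuousOn (fun τ => Real.log (s / τ)) (Set.uIcc a s) := by
    rw [Set.uIcc_of_le has.le]
    have hs : 0 < s := ha.trans has
    refine ContinuousOn.log ?_ ?_
    · refine continuousOn_const.div continuousOn_id ?_
      intro x hx; exact (ha.trans_le hx.1).ne'
    · intro x hx
      have := ha.trans_le hx.1
      positivity
  exact this.rpow_const (fun x hx => Or.inr hp.le)

lemma deriv_logpow {s τ p : ℝ} (hτ : 0 < τ) (hp : 0 < p) (has : τ < s) :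
    HasDerivAt (fun τ => - (Real.log (s / τ) ^ p / p)) (Real.log (s / τ) ^ (p - 1) / τ) τ := by
  have hs := hτ.trans has
  have hl : 0 < Real.log (s / τ) := Real.log_pos ((one_lt_div hτ).2 has)
  have h1 : HasDerivAt (fun τ => Real.log (s / τ)) (-τ⁻¹) τ := by
    have : HasDerivAt (fun τ => Real.log s - Real.log τ) (-τ⁻¹) τ := by
      simpa using (Real.hasDerivAt_log hτ.ne').const_sub (Real.log s)
    refine this.congr_of_eventuallyEq ?_
    filter_upwards [lt_mem_nhds hτ] with u hu
    rw [Real.log_div hs.ne' hu.ne']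
  have h2 := ((h1.rpow_const (p := p) (Or.inl hl.ne')).div_const p).neg
  convert! h2 using 1
  field_simp

lemma int_left' {s a p : ℝ} (ha : 0 < a) (hp : 0 < p) (has : a < s) :
    IntervalIntegrable (fun τ => Real.log (s / τ) ^ (p - 1) / τ) volume a s := by
  apply intervalIntegral.intervalIntegrable_deriv_of_nonneg
    (g := fun τ => - (Real.log (s / τ) ^ p / p))
  · exact ((cont_logpow ha hp has).div_const p).neg
  · intro x hx
    rw [min_eq_left has.le, max_eq_right has.le] at hx
    exact deriv_logpow (ha.trans hx.1) hp hx.2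
  · intro x hx
    rw [min_eq_left has.le, max_eq_right has.le] at hx
    have h0 := ha.trans hx.1
    have hl : 0 < Real.log (s / x) := Real.log_pos ((one_lt_div h0).2 hx.2)
    positivity

lemma int_left {s a p : ℝ} (ha : 0 < a) (hp : 0 < p) (has : a < s) :
    IntervalIntegrable (fun τ => Real.log (s / τ) ^ (p - 1)) volume a s := by
  have := (int_left' ha hp has).mul_continuousOn (g := fun τ => τ) continuousOn_id
  refine this.congr ?_
  intro x hx
  rw [Set.uIoc_of_le has.le] at hx
  have := (ha.trans hx.1).ne'
  simp only
  field_simp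

lemma int_right {s B p : ℝ} (hs : 0 < s) (hp : 0 < p) (hsB : s < B) :
    IntervalIntegrable (fun τ => Real.log (τ / s) ^ (p - 1)) volume s B := by
  have h : IntervalIntegrable (fun τ => Real.log (τ / s) ^ (p - 1) / τ) volume s B := by
    apply intervalIntegral.intervalIntegrable_deriv_of_nonneg
      (g := fun τ => (Real.log (τ / s) ^ p / p))
    · refine ContinuousOn.div_const (ContinuousOn.rpow_const (ContinuousOn.log ?_ ?_) ?_) _
      · fun_prop
      · intro x hx
        rw [Set.uIcc_of_le hsB.le] at hx
        have := hs.trans_le hx.1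
        positivity
      · intro x hx; exact Or.inr hp.le
    · intro x hx
      rw [min_eq_left hsB.le, max_eq_right hsB.le] at hx
      have hx0 := hs.trans hx.1
      have hl : 0 < Real.log (x / s) := Real.log_pos ((one_lt_div hs).2 hx.1)
      have h1 : HasDerivAt (fun τ => Real.log (τ / s)) (x⁻¹) x := by
        have : HasDerivAt (fun τ => Real.log τ - Real.log s) (x⁻¹) x := by
          simpa using (Real.hasDerivAt_log hx0.ne').sub_const (Real.log s)
        refine this.congr_of_eventuallyEq ?_
        filter_upwards [lt_mem_nhds hx0] with u hu
        rw [Real.log_div hu.ne' hs.ne']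
      have h2 := ((h1.rpow_const (p := p) (Or.inl hl.ne')).div_const p)
      convert! h2 using 1
      field_simp
    · intro x hx
      rw [min_eq_left hsB.le, max_eq_right hsB.le] at hx
      have hx0 := hs.trans hx.1
      have hl : 0 < Real.log (x / s) := Real.log_pos ((one_lt_div hs).2 hx.1)
      positivity
  have := h.mul_continuousOn (g := fun τ => τ) continuousOn_id
  refine this.congr ?_
  intro x hx
  rw [Set.uIoc_of_le hsB.le] at hx
  have := (hs.trans hx.1).ne'
  simp only
  field_simp

lemma int_WW {a t B p : ℝ} (ha : 0 < a) (hat : a < t) (htB : t < B) (hp : 0 < p) :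
    IntervalIntegrable (fun τ => WW p |Real.log (t / τ)|) volume a B := by
  have ht := ha.trans hat
  have h1 : IntervalIntegrable (fun τ => |Real.log (t / τ)| ^ (p - 1)) volume a B := by
    refine IntervalIntegrable.trans (b := t) ?_ ?_
    · refine (int_left ha hp hat).congr ?_
      intro x hx
      rw [Set.uIoc_of_le hat.le] at hx
      simp only
      rw [abs_of_nonneg (Real.log_nonneg ((one_le_div (ha.trans hx.1)).2 hx.2))]
    · refine (int_right ht hp htB).congr ?_
      intro x hx
      rw [Set.uIoc_of_le htB.le] at hx
      simp only
      rw [← abs_neg, ← Real.log_inv, inv_div,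
        abs_of_nonneg (Real.log_nonneg ((one_le_div ht).2 hx.1.le))]
  have h2 : ContinuousOn (fun τ => |Real.log (t / τ)| ^ 2) (Set.uIcc a B) := by
    rw [Set.uIcc_of_le (hat.trans htB).le]
    refine ((ContinuousOn.log (continuousOn_const.div continuousOn_id ?_) ?_).abs).pow 2
    · intro x hx; exact (ha.trans_le hx.1).ne'
    · intro x hx
      have := ha.trans_le hx.1
      exact (div_pos ht this).ne'
  exact (h1.add intervalIntegrable_const).add h2.intervalIntegrable

lemma ibp {s a p : ℝ} {x : ℝ → ℝ} (hx : ContDiff ℝ 1 x) (ha : 0 < a) (hp : 0 < p) (has : a < s) :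
    ∫ τ in a..s, (Real.log (s / τ)) ^ (p - 1) * (x τ - x a) / τ
      = (∫ τ in a..s, (Real.log (s / τ)) ^ p * deriv x τ) / p := by
  have hd : Continuous (deriv x) := hx.continuous_deriv le_rfl
  have h := intervalIntegral.integral_deriv_mul_eq_sub_of_hasDerivAt
    (u := fun τ => - (Real.log (s / τ) ^ p / p)) (u' := fun τ => Real.log (s / τ) ^ (p - 1) / τ)
    (v := fun τ => x τ - x a) (v' := deriv x) (a := a) (b := s)
    ((cont_logpow ha hp has).div_const p).neg
    (by have := hx.continuous; fun_prop)
    (by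
      intro y hy
      rw [min_eq_left has.le, max_eq_right has.le] at hy
      exact deriv_logpow (ha.trans hy.1) hp hy.2)
    (by
      intro y hy
      exact ((hx.differentiable (by norm_num)) y).hasDerivAt.sub_const _)
    (int_left' ha hp has) (hd.intervalIntegrable _ _)
  rw [intervalIntegral.integral_add] at h
  · simp only [sub_self, mul_zero, div_self (ha.trans has).ne', Real.log_one,
      Real.zero_rpow hp.ne', zero_div, neg_zero, zero_mul] at h
    have e1 : (∫ τ in a..s, (Real.log (s / τ)) ^ (p - 1) * (x τ - x a) / τ)
      = ∫ τ in a..s, (Real.log (s / τ)) ^ (p - 1) / τ * (x τ - x a) := by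
      congr 1; ext τ; ring
    have e2 : (∫ τ in a..s, -(Real.log (s / τ) ^ p / p) * deriv x τ)
      = - ((∫ τ in a..s, (Real.log (s / τ)) ^ p * deriv x τ) / p) := by
      rw [← intervalIntegral.integral_div, ← intervalIntegral.integral_neg]
      congr 1; ext τ; ring
    rw [e1]; linarith
  · exact (int_left' ha hp has).mul_continuousOn (by have := hx.continuous; fun_prop)
  · exact (hd.intervalIntegrable _ _).continuousOn_mul ((cont_logpow ha hp has).div_const p).neg

lemma hasDerivAt_int_lip' {μ : Measure ℝ} {F : ℝ → ℝ → ℝ} {F' bound : ℝ → ℝ} {x₀ : ℝ} {s : Set ℝ}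
    (hs : s ∈ nhds x₀)
    (hF_meas : ∀ x ∈ s, AEStronglyMeasurable (F x) μ) (hF_int : Integrable (F x₀) μ)
    (hF'_meas : AEStronglyMeasurable F' μ)
    (h_lipsch : ∀ᵐ a ∂μ, ∀ x ∈ s, ‖F x a - F x₀ a‖ ≤ bound a * ‖x - x₀‖)
    (bound_integrable : Integrable bound μ)
    (h_diff : ∀ᵐ a ∂μ, HasDerivAt (fun x => F x a) (F' a) x₀) :
    HasDerivAt (fun x ↦ ∫ a, F x a ∂μ) (∫ a, F' a ∂μ) x₀ := by
  set L : ℝ →L[ℝ] ℝ →L[ℝ] ℝ := ContinuousLinearMap.smulRightL ℝ ℝ ℝ 1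
  replace h_diff : ∀ᵐ a ∂μ, HasFDerivAt (fun x => F x a) (L (F' a)) x₀ :=
    h_diff.mono fun x hx ↦ hx.hasFDerivAt
  have hm : AEStronglyMeasurable (L ∘ F') μ := L.continuous.comp_aestronglyMeasurable hF'_meas
  obtain ⟨hF'_int, key⟩ := hasFDerivAt_integral_of_dominated_loc_of_lip'
    hs hF_meas hF_int hm h_lipsch bound_integrable h_diff
  replace hF'_int : Integrable F' μ := by
    have := hF'_int.apply_continuousLinearMap (1 : ℝ)
    simpa [L] using this
  have h2 := key.hasDerivAt
  have e : (∫ a, L (F' a) ∂μ) = L (∫ a, F' a ∂μ) := L.integral_comp_comm hF'_int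
  simp only [Function.comp_def] at h2
  rw [e] at h2
  simpa [L] using h2

lemma derivH {a t d : ℝ} {p x : ℝ → ℝ} (ha : 0 < a) (hat : a < t) (hx : ContDiff ℝ 1 x)
    (hp0 : 0 < p t) (hp1 : p t < 1) (hpd : HasDerivAt p d t) :
    HasDerivAt (fun s => ∫ τ in a..s, (Real.log (s / τ)) ^ (p s) * deriv x τ)
      (∫ τ in a..t, (1 / t * p t * Real.log (t / τ) ^ (p t - 1)
        + d * Real.log (t / τ) ^ p t * Real.log (Real.log (t / τ))) * deriv x τ) t := by
  have hd : Continuous (deriv x) := hx.continuous_deriv le_rfl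
  have ht := ha.trans hat
  set p0 := p t / 2 with hp0d
  have hp00 : 0 < p0 := by positivity
  obtain ⟨C, hC⟩ := hpd.isBigO_sub.bound
  obtain ⟨C', hC'⟩ := (Real.hasDerivAt_log ht.ne').isBigO_sub.bound
  have hS : ∀ᶠ s in nhds t, a < s ∧ s < t + 1 ∧ p0 < p s ∧ p s < 1 ∧
      ‖p s - p t‖ ≤ C * ‖s - t‖ ∧ ‖Real.log s - Real.log t‖ ≤ C' * ‖s - t‖ := by
    filter_upwards [hC, hC', lt_mem_nhds hat, gt_mem_nhds (show t < t + 1 by linarith),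
      hpd.continuousAt.eventually (lt_mem_nhds (show p0 < p t by linarith)),
      hpd.continuousAt.eventually (gt_mem_nhds hp1)] with s h1 h2 h3 h4 h5 h6
    exact ⟨h3, h4, h5, h6, h1, h2⟩
  have hmeas : ∀ s, Measurable (fun τ => (max 0 (Real.log (s / τ))) ^ (p s) * deriv x τ) := by
    intro s
    have := hd.measurable
    exact ((measurable_const.max (Real.measurable_log.comp
      (measurable_const.div measurable_id))).pow_const _).mul this
  set f : ℝ → ℝ := fun τ => (1 / t * p t * Real.log (t / τ) ^ (p t - 1)
        + d * Real.log (t / τ) ^ p t * Real.log (Real.log (t / τ))) * deriv x τ with hf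
  have hfm : Measurable f := by
    have := hd.measurable
    have hl : Measurable (fun τ => Real.log (t / τ)) :=
      Real.measurable_log.comp (measurable_const.div measurable_id)
    exact ((((hl.pow_const _).const_mul _)).add
      (((hl.pow_const _).const_mul _).mul (Real.measurable_log.comp hl))).mul this
  -- conversion
  have conv : ∀ s, a < s → s < t + 1 → 0 < p s →
      ∫ τ in a..s, (Real.log (s / τ)) ^ (p s) * deriv x τ
        = ∫ τ in Set.Ioc a (t + 1), (max 0 (Real.log (s / τ))) ^ (p s) * deriv x τ := by
    intro s h1 h2 h3
    rw [intervalIntegral.integral_of_le h1.le]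
    symm
    rw [setIntegral_eq_of_subset_of_forall_sdiff_eq_zero measurableSet_Ioc
      (Set.Ioc_subset_Ioc_right h2.le)]
    · apply setIntegral_congr_fun measurableSet_Ioc
      intro τ hτ
      simp only
      rw [max_eq_right (Real.log_nonneg ((one_le_div (ha.trans hτ.1)).2 hτ.2))]
    · intro τ hτ
      have hτ0 : 0 < τ := ha.trans hτ.1.1
      have : s < τ := by
        by_contra hc
        exact hτ.2 ⟨hτ.1.1, not_lt.1 hc⟩
      have hl : Real.log (s / τ) ≤ 0 :=
        Real.log_nonpos (by have := ha.trans h1; positivity) ((div_le_one hτ0).2 this.le)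
      rw [max_eq_left hl, Real.zero_rpow h3.ne', zero_mul]
  have key := hasDerivAt_int_lip' (μ := volume.restrict (Set.Ioc a (t + 1))) (x₀ := t)
    (F := fun s τ => (max 0 (Real.log (s / τ))) ^ (p s) * deriv x τ)
    (F' := (Set.Iio t).indicator f)
    (bound := fun τ => WW p0 |Real.log (t / τ)| * ((C + C') * |deriv x τ|)) hS
    (fun s _ => (hmeas s).aestronglyMeasurable) ?_
    (hfm.indicator measurableSet_Iio).aestronglyMeasurable ?_ ?_ ?_
  · have e : (∫ τ in Set.Ioc a (t + 1), (Set.Iio t).indicator f τ) = ∫ τ in a..t, f τ := by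
      rw [setIntegral_indicator measurableSet_Iio, intervalIntegral.integral_of_le hat.le,
        integral_Ioc_eq_integral_Ioo]
      congr 2
      ext τ; simp only [Set.mem_inter_iff, Set.mem_Ioc, Set.mem_Iio, Set.mem_Ioo]
      constructor
      · rintro ⟨⟨h1, h2⟩, h3⟩; exact ⟨h1, h3⟩
      · rintro ⟨h1, h3⟩; exact ⟨⟨h1, by linarith⟩, h3⟩
    rw [e] at key
    refine key.congr_of_eventuallyEq ?_
    filter_upwards [hS] with s hs
    exact conv s hs.1 hs.2.1 (hp00.trans hs.2.2.1)
  · -- integrable at t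
    have hc : ContinuousOn (fun τ => (max 0 (Real.log (t / τ))) ^ (p t) * deriv x τ)
        (Set.Icc a (t + 1)) := by
      refine ContinuousOn.mul (ContinuousOn.rpow_const (ContinuousOn.sup continuousOn_const
        (ContinuousOn.log (continuousOn_const.div continuousOn_id ?_) ?_)) ?_) hd.continuousOn
      · intro x hx; exact (ha.trans_le hx.1).ne'
      · intro x hx
        have := ha.trans_le hx.1
        exact (div_pos ht this).ne'
      · intro x hx; exact Or.inr hp0.le
    exact (hc.integrableOn_Icc).mono_set Set.Ioc_subset_Icc_self
  · have hne : ∀ᵐ τ ∂(volume.restrict (Set.Ioc a (t + 1))), τ ≠ t :=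
      ae_restrict_of_ae (Measure.ae_ne volume t)
    filter_upwards [ae_restrict_mem measurableSet_Ioc, hne] with τ hτ hτt s hs
    obtain ⟨h1, h2, h3, h4, h5, h6⟩ := hs
    have hτ0 : 0 < τ := ha.trans hτ.1
    have hs0 := ha.trans h1
    have hy : Real.log (t / τ) ≠ 0 := by
      rw [Real.log_div ht.ne' hτ0.ne', sub_ne_zero]
      intro h
      exact hτt (Real.log_injOn_pos hτ0 ht h.symm)
    have hc := core (z := Real.log (s / τ)) hp00 h3.le h4.le (show p0 ≤ p t by linarith) hp1.le hy
    have e : Real.log (s / τ) - Real.log (t / τ) = Real.log s - Real.log t := by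
      rw [Real.log_div ht.ne' hτ0.ne', Real.log_div hs0.ne' hτ0.ne']; ring
    rw [e] at hc
    have hW0 : 0 ≤ WW p0 |Real.log (t / τ)| :=
      (Real.rpow_pos_of_pos (abs_pos.2 hy) _).le.trans
        (WW_pow h3.le h4.le (abs_pos.2 hy))
    simp only [Real.norm_eq_abs] at *
    rw [← sub_mul, abs_mul]
    calc _ ≤ (WW p0 |Real.log (t / τ)| * (C' * |s - t| + C * |s - t|)) * |deriv x τ| := by
          apply mul_le_mul_of_nonneg_right _ (abs_nonneg _)
          exact hc.trans (mul_le_mul_of_nonneg_left (add_le_add h6 h5) hW0)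
      _ = _ := by ring
  · have := (int_WW ha hat (show t < t + 1 by linarith) hp00).mul_continuousOn
      (g := fun τ => (C + C') * |deriv x τ|) (by fun_prop)
    rwa [intervalIntegrable_iff_integrableOn_Ioc_of_le (by linarith)] at this
  · have hne : ∀ᵐ τ ∂(volume.restrict (Set.Ioc a (t + 1))), τ ≠ t :=
      ae_restrict_of_ae (Measure.ae_ne volume t)
    filter_upwards [ae_restrict_mem measurableSet_Ioc, hne] with τ hτ hτt
    have hτ0 : 0 < τ := ha.trans hτ.1
    rcases lt_or_gt_of_ne hτt with h | h
    · rw [Set.indicator_of_mem (show τ ∈ Set.Iio t from h)]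
      have hl : 0 < Real.log (t / τ) := Real.log_pos ((one_lt_div hτ0).2 h)
      have h1 : HasDerivAt (fun s => Real.log (s / τ)) (1 / t) t := by
        have : HasDerivAt (fun s => Real.log s - Real.log τ) (1 / t) t := by
          simpa using (Real.hasDerivAt_log ht.ne').sub_const (Real.log τ)
        refine this.congr_of_eventuallyEq ?_
        filter_upwards [lt_mem_nhds ht] with u hu
        rw [Real.log_div hu.ne' hτ0.ne']
      refine ((h1.rpow hpd hl).mul_const (deriv x τ)).congr_of_eventuallyEq ?_
      filter_upwards [lt_mem_nhds h] with s hs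
      rw [max_eq_right (Real.log_nonneg ((one_le_div hτ0).2 (le_of_lt hs)))]
    · rw [Set.indicator_of_notMem (by simp [h.le])]
      refine (hasDerivAt_const t (0:ℝ)).congr_of_eventuallyEq ?_
      filter_upwards [gt_mem_nhds h, hS] with s hs hs'
      have hs0 := ha.trans hs'.1
      have hl : Real.log (s / τ) ≤ 0 :=
        Real.log_nonpos (by positivity) ((div_le_one hτ0).2 (le_of_lt hs))
      rw [max_eq_left hl, Real.zero_rpow (hp00.trans hs'.2.2.1).ne', zero_mul]

/-- relation between the type 2 and type 1 left Caputo–Hadamard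
fractional derivatives of variable order. -/
theorem CHD2_eq_CHD1_add
    (a b : ℝ) (ha : 0 < a) (hab : a < b) (α x : ℝ → ℝ)
    (hα : ∀ t ∈ Set.Icc a b, α t ∈ Set.Ioo (0 : ℝ) 1)
    (hαd : ∀ t ∈ Set.Icc a b, DifferentiableAt ℝ α t)
    (hx : ContDiff ℝ 1 x)
    (t : ℝ) (ht : t ∈ Set.Ioc a b) :
    CHD2 a α x t
      = CHD1 a α x t
        + (t * deriv α t / Real.Gamma (2 - α t)) *
            ∫ τ in a..t, (Real.log (t / τ)) ^ (1 - α t) * deriv x τ *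
              (1 / (1 - α t) - Real.log (Real.log (t / τ))) := by
  obtain ⟨hat, htb⟩ := ht
  have ht0 := ha.trans hat
  have htI : t ∈ Set.Icc a b := ⟨hat.le, htb⟩
  obtain ⟨hα0, hα1⟩ := hα t htI
  have hd : Continuous (deriv x) := hx.continuous_deriv le_rfl
  have hα' := (hαd t htI).hasDerivAt
  have hpd : HasDerivAt (fun s => 1 - α s) (-deriv α t) t := hα'.const_sub 1
  have hp : 0 < 1 - α t := by linarith
  have hH := derivH (p := fun s => 1 - α s) ha hat hx hp (by linarith) hpd
  have hF := hH.div hpd hp.ne'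
  have hev : (fun s : ℝ => ∫ τ in a..s, (Real.log (s / τ)) ^ (-(α s)) * (x τ - x a) / τ)
      =ᶠ[nhds t] ((fun s => ∫ τ in a..s, Real.log (s / τ) ^ (1 - α s) * deriv x τ) /
        fun s => 1 - α s) := by
    filter_upwards [lt_mem_nhds hat,
      hα'.continuousAt.eventually (gt_mem_nhds hα1)] with s h1 h2
    have := ibp hx ha (show 0 < 1 - α s by linarith) h1
    simp only [Pi.div_apply]
    rw [← this]
    congr 1; ext τ; congr 3; ring
  have hD := (hF.congr_of_eventuallyEq hev).deriv
  unfold CHD2 CHD1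
  rw [hD]
  have hc := cont_logpow ha hp hat
  have i1 : IntervalIntegrable (fun τ => Real.log (t / τ) ^ (-(α t)) * deriv x τ) volume a t := by
    have := (int_left ha hp hat).mul_continuousOn (hd.continuousOn (s := Set.uIcc a t))
    rwa [show 1 - α t - 1 = -(α t) by ring] at this
  have i2 : IntervalIntegrable (fun τ => Real.log (t / τ) ^ (1 - α t) * deriv x τ) volume a t :=
    (hc.mul hd.continuousOn).intervalIntegrable
  have i3 : IntervalIntegrable (fun τ => Real.log (t / τ) ^ (1 - α t)
      * Real.log (Real.log (t / τ)) * deriv x τ) volume a t := by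
    have h1 : ContinuousOn (fun τ => (Real.log (t / τ) ^ (1 - α t)
      * Real.log (Real.log (t / τ) ^ (1 - α t))) / (1 - α t) * deriv x τ) (Set.uIcc a t) :=
      ((Real.continuous_mul_log.comp_continuousOn hc).div_const _).mul hd.continuousOn
    refine h1.intervalIntegrable.congr_ae ?_
    have hne : ∀ᵐ τ ∂(volume.restrict (Set.uIoc a t)), τ ≠ t :=
      ae_restrict_of_ae (Measure.ae_ne volume t)
    filter_upwards [ae_restrict_mem measurableSet_uIoc, hne] with τ hτ hτt
    rw [Set.uIoc_of_le hat.le] at hτ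
    have hτ0 := ha.trans hτ.1
    rw [Real.log_rpow (Real.log_pos ((one_lt_div hτ0).2 (lt_of_le_of_ne hτ.2 hτt)))]
    field_simp
  have e1 : (∫ τ in a..t, (1 / t * (1 - α t) * Real.log (t / τ) ^ (1 - α t - 1)
        + -deriv α t * Real.log (t / τ) ^ (1 - α t) * Real.log (Real.log (t / τ))) * deriv x τ)
      = 1 / t * (1 - α t) * (∫ τ in a..t, Real.log (t / τ) ^ (-(α t)) * deriv x τ)
        + -deriv α t * (∫ τ in a..t, Real.log (t / τ) ^ (1 - α t)
            * Real.log (Real.log (t / τ)) * deriv x τ) := by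
    rw [← intervalIntegral.integral_const_mul, ← intervalIntegral.integral_const_mul,
      ← intervalIntegral.integral_add (i1.const_mul _) (i3.const_mul _)]
    rw [show 1 - α t - 1 = -(α t) by ring]
    congr 1; ext τ; ring
  have e2 : (∫ τ in a..t, (Real.log (t / τ)) ^ (1 - α t) * deriv x τ *
              (1 / (1 - α t) - Real.log (Real.log (t / τ))))
      = 1 / (1 - α t) * (∫ τ in a..t, Real.log (t / τ) ^ (1 - α t) * deriv x τ)
        - (∫ τ in a..t, Real.log (t / τ) ^ (1 - α t)
            * Real.log (Real.log (t / τ)) * deriv x τ) := by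
    rw [← intervalIntegral.integral_const_mul,
      ← intervalIntegral.integral_sub (i2.const_mul _) i3]
    congr 1; ext τ; ring
  have hG : Real.Gamma (2 - α t) = (1 - α t) * Real.Gamma (1 - α t) := by
    rw [← Real.Gamma_add_one hp.ne']; congr 1; ring
  have hG0 : Real.Gamma (1 - α t) ≠ 0 := (Real.Gamma_pos_of_pos hp).ne'
  rw [e1, e2, hG]
  have hpne := hp.ne'
  generalize (∫ τ in a..t, Real.log (t / τ) ^ (1 - α t) * deriv x τ) = X
  generalize (∫ τ in a..t, Real.log (t / τ) ^ (-(α t)) * deriv x τ) = Y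
  generalize (∫ τ in a..t, Real.log (t / τ) ^ (1 - α t)
            * Real.log (Real.log (t / τ)) * deriv x τ) = Z
  generalize Real.Gamma (1 - α t) = G at *
  generalize deriv α t = d at *
  field_simp
  ring
end

section
/- Let 0 < a < b, let α : [a,b] → (0,1) be differentiable, and let x : [a,b] → ℝ be continuously differentiable. Then for every t ∈ (a,b], (D₃x)(t) = (D₂x)(t) + (t·α'(t)·ψ(1−α(t))/Γ(1−α(t))) ∫_a^t (ln(t/τ))^{−α(t)} (x(τ)−x(a))/τ dτ. -/
/-- The left Caputo–Hadamard fractional derivative of variable order `α(t)`, type 3. -/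
noncomputable def CHD3 (a : ℝ) (α x : ℝ → ℝ) (t : ℝ) : ℝ :=
  t * deriv (fun s : ℝ => (1 / Real.Gamma (1 - α s)) *
    ∫ τ in a..s, (Real.log (s / τ)) ^ (-(α s)) * (x τ - x a) / τ) t

open Set Filter Topology MeasureTheory in
lemma aux_rpow_lip (w p q : ℝ) (hw : w ∈ Ioo (0:ℝ) 1) (hp : 1 ≤ p) (hq : 1 ≤ q) :
    |w ^ p - w ^ q| ≤ |p - q| := by
  have hd : ∀ r ∈ Ici (1:ℝ), HasDerivWithinAt (fun r : ℝ => w ^ r) (w ^ r * Real.log w) (Ici 1) r := by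
    intro r _
    exact (Real.hasStrictDerivAt_const_rpow hw.1 r).hasDerivAt.hasDerivWithinAt
  have hb : ∀ r ∈ Ici (1:ℝ), ‖w ^ r * Real.log w‖ ≤ 1 := by
    intro r hr
    have h1 : w ^ r ≤ w := by
      simpa using Real.rpow_le_rpow_of_exponent_ge hw.1 hw.2.le hr
    have h2 := Real.abs_log_mul_self_lt w hw.1 hw.2.le
    have h0 : 0 < w ^ r := Real.rpow_pos_of_pos hw.1 r
    rw [abs_mul, abs_of_pos hw.1] at h2
    rw [Real.norm_eq_abs, abs_mul, abs_of_pos h0]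
    nlinarith [abs_nonneg (Real.log w)]
  have := Convex.norm_image_sub_le_of_norm_hasDerivWithin_le hd hb (convex_Ici 1) (x := q) (y := p) hq hp
  simpa using this

open Set Filter Topology MeasureTheory in
lemma aux_lip (f : ℝ → ℝ) (t : ℝ) (hf : DifferentiableAt ℝ f t) :
    ∃ C, 0 ≤ C ∧ ∀ᶠ s in 𝓝 t, |f s - f t| ≤ C * |s - t| := by
  obtain ⟨C, hC, h⟩ := hf.isBigO_sub.exists_nonneg
  exact ⟨C, hC, by simpa using h.bound⟩

open Set Filter Topology MeasureTheory in
lemma aux_diff (y l L p : ℝ → ℝ) (t : ℝ) (hy : ContDiff ℝ 1 y) (hl : DifferentiableAt ℝ l t)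
    (hL : DifferentiableAt ℝ L t) (hp : DifferentiableAt ℝ p t) (hpt : 1 < p t) :
    DifferentiableAt ℝ (fun s => ∫ w in Ioo (0:ℝ) 1, y (l s - L s * w ^ (p s))) t := by
  obtain ⟨Cl, hCl, hl1⟩ := aux_lip l t hl
  obtain ⟨CL, hCL, hL1⟩ := aux_lip L t hL
  obtain ⟨Cp, hCp, hp1⟩ := aux_lip p t hp
  have hl2 : ∀ᶠ s in 𝓝 t, |l s| < |l t| + 1 :=
    hl.continuousAt.abs.eventually_lt continuousAt_const (by linarith)
  have hL2 : ∀ᶠ s in 𝓝 t, |L s| < |L t| + 1 :=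
    hL.continuousAt.abs.eventually_lt continuousAt_const (by linarith)
  have hp2 : ∀ᶠ s in 𝓝 t, 1 < p s := continuousAt_const.eventually_lt hp.continuousAt hpt
  set M := |l t| + 1 + (|L t| + 1) with hM
  obtain ⟨K, hK⟩ := (hy.locallyLipschitz.locallyLipschitzOn (s := Icc (-M) M)).exists_lipschitzOnWith_of_compact
    isCompact_Icc
  have hmem : ∀ s, |l s| < |l t| + 1 → |L s| < |L t| + 1 → 1 < p s → ∀ w ∈ Ioo (0:ℝ) 1,
      l s - L s * w ^ (p s) ∈ Icc (-M) M := by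
    intro s h1 h2 h3 w hw
    have h4 : |w ^ (p s)| ≤ 1 := by
      rw [abs_of_pos (Real.rpow_pos_of_pos hw.1 _)]
      exact Real.rpow_le_one hw.1.le hw.2.le (by linarith)
    refine abs_le.1 ?_
    calc _ ≤ |l s| + |L s * w ^ (p s)| := abs_sub _ _
      _ ≤ M := by
        rw [abs_mul]; nlinarith [abs_nonneg (L s), abs_nonneg (w ^ p s)]
  have hmeas : ∀ s, Measurable (fun w : ℝ => y (l s - L s * w ^ (p s))) := by
    intro s
    exact hy.continuous.measurable.comp (by fun_prop)
  let d : ℝ → ℝ := fun w => deriv y (l t - L t * w ^ (p t)) *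
    (deriv l t - (deriv L t * w ^ (p t) + L t * (Real.log w * deriv p t * w ^ (p t))))
  have hd : Measurable d := by
    have h1 : Measurable (deriv y) := measurable_deriv y
    exact (h1.comp (by fun_prop)).mul (by fun_prop)
  obtain ⟨s, hs, hall⟩ := (hl1.and (hL1.and (hp1.and (hl2.and (hL2.and hp2))))).exists_mem
  have key := hasFDerivAt_integral_of_dominated_loc_of_lip' (𝕜 := ℝ) (μ := volume.restrict (Ioo (0:ℝ) 1))
    (F := fun s w => y (l s - L s * w ^ (p s))) (x₀ := t) (s := s)
    (F' := fun w => ContinuousLinearMap.toSpanSingleton ℝ (d w))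
    (bound := fun _ => K * (Cl + (CL + |L t| * Cp))) hs
    (fun u _ => (hmeas u).aestronglyMeasurable) ?_ ?_ ?_ ?_ ?_
  · exact key.2.differentiableAt
  · obtain ⟨B, hB⟩ := isCompact_Icc.exists_bound_of_continuousOn (s := Icc (-M) M) hy.continuous.continuousOn
    refine Integrable.of_bound (hmeas t).aestronglyMeasurable B ?_
    filter_upwards [ae_restrict_mem measurableSet_Ioo] with w hw
    exact hB _ (hmem t (by linarith) (by linarith) hpt w hw)
  · exact (ContinuousLinearMap.toSpanSingletonCLE (𝕜 := ℝ) (E := ℝ)).continuous.comp_aestronglyMeasurable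
      hd.aestronglyMeasurable
  · filter_upwards [ae_restrict_mem measurableSet_Ioo] with w hw u hu
    obtain ⟨h1, h2, h3, h4, h5, h6⟩ := hall u hu
    have h7 := hK.dist_le_mul _ (hmem u h4 h5 h6 w hw) _ (hmem t (by linarith) (by linarith) hpt w hw)
    rw [dist_eq_norm, dist_eq_norm] at h7
    refine h7.trans ?_
    rw [mul_assoc]
    refine mul_le_mul_of_nonneg_left ?_ K.2
    have h8 := aux_rpow_lip w (p u) (p t) hw h6.le hpt.le
    have h9 : |w ^ (p u)| ≤ 1 := by
      rw [abs_of_pos (Real.rpow_pos_of_pos hw.1 _)]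
      exact Real.rpow_le_one hw.1.le hw.2.le (by linarith)
    have e : l u - L u * w ^ p u - (l t - L t * w ^ p t)
      = (l u - l t) - ((L u - L t) * w ^ p u + L t * (w ^ p u - w ^ p t)) := by ring
    rw [e, Real.norm_eq_abs, Real.norm_eq_abs]
    have i1 := abs_sub (l u - l t) ((L u - L t) * w ^ p u + L t * (w ^ p u - w ^ p t))
    have i2 := abs_add_le ((L u - L t) * w ^ p u) (L t * (w ^ p u - w ^ p t))
    rw [abs_mul, abs_mul] at i2
    have i3 : |L u - L t| * |w ^ p u| ≤ |L u - L t| := mul_le_of_le_one_right (abs_nonneg _) h9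
    have i4 : |L t| * |w ^ p u - w ^ p t| ≤ |L t| * (Cp * |u - t|) :=
      mul_le_mul_of_nonneg_left (h8.trans h3) (abs_nonneg _)
    linarith
  · exact integrable_const _
  · filter_upwards [ae_restrict_mem measurableSet_Ioo] with w hw
    have h1 : HasDerivAt (fun s => w ^ (p s)) (Real.log w * deriv p t * w ^ (p t)) t :=
      hp.hasDerivAt.const_rpow hw.1
    have h2 := hl.hasDerivAt.sub (hL.hasDerivAt.mul h1)
    have h3 : HasDerivAt y (deriv y (l t - L t * w ^ (p t))) (l t - L t * w ^ (p t)) :=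
      (hy.differentiable (by norm_num)).differentiableAt.hasDerivAt
    exact (h3.comp t h2).hasFDerivAt

open Set Filter Topology MeasureTheory in
lemma aux_subst (a s β : ℝ) (x : ℝ → ℝ) (ha : 0 < a) (hs : a < s) (h0 : 0 < β) (h1 : β < 1) :
    ∫ τ in a..s, (Real.log (s / τ)) ^ (-β) * (x τ - x a) / τ
     = (Real.log s - Real.log a) ^ (1 - β) * (1 - β)⁻¹ *
      ∫ w in Ioo (0:ℝ) 1, (x (Real.exp (Real.log s - (Real.log s - Real.log a) * w ^ ((1 - β)⁻¹))) - x a) := by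
  have hs0 : 0 < s := ha.trans hs
  set L := Real.log s - Real.log a with hLdef
  have hL : 0 < L := sub_pos.2 (Real.log_lt_log ha hs)
  set p := (1 - β)⁻¹ with hp
  have hpp : 0 < p := inv_pos.2 (by linarith)
  let f : ℝ → ℝ := fun w => Real.exp (Real.log s - L * w ^ p)
  let f' : ℝ → ℝ := fun w => Real.exp (Real.log s - L * w ^ p) * (-(L * (p * w ^ (p - 1))))
  have key := integral_Icc_deriv_smul_of_deriv_nonpos (a := 0) (b := 1) (f := f) (f' := f')
    (g := fun τ => (Real.log (s / τ)) ^ (-β) * (x τ - x a) / τ) ?_ ?_ ?_ zero_le_one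
  · have f1 : f 1 = a := by simp [f, hLdef, Real.exp_log ha]
    have f0 : f 0 = s := by simp [f, Real.zero_rpow hpp.ne', Real.exp_log hs0]
    rw [f1, f0] at key
    rw [intervalIntegral.integral_of_le hs.le, ← integral_Icc_eq_integral_Ioc, ← neg_eq_iff_eq_neg.2 key,
      integral_Icc_eq_integral_Ioo, ← integral_neg, ← integral_const_mul]
    refine setIntegral_congr_fun measurableSet_Ioo fun w hw => ?_
    have e1 : Real.log (s / f w) = L * w ^ p := by
      rw [Real.log_div hs0.ne' (Real.exp_pos _).ne', Real.log_exp]; ring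
    have e2 : (L * w ^ p) ^ (-β) = L ^ (-β) * w ^ (p * -β) := by
      rw [Real.mul_rpow hL.le (Real.rpow_nonneg hw.1.le _), ← Real.rpow_mul hw.1.le]
    have e3 : w ^ (p * -β) * w ^ (p - 1) = 1 := by
      rw [← Real.rpow_add hw.1]
      have : p * -β + (p - 1) = 0 := by
        have : p * (1 - β) = 1 := inv_mul_cancel₀ (by linarith)
        linarith
      rw [this, Real.rpow_zero]
    have e4 : L ^ (1 - β) = L * L ^ (-β) := by
      rw [sub_eq_add_neg, Real.rpow_add hL, Real.rpow_one]
    have hf0 : f w ≠ 0 := (Real.exp_pos _).ne'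
    simp only [smul_eq_mul]
    rw [e1, e2, e4]
    change -(f w * (-(L * (p * w ^ (p - 1)))) * (L ^ (-β) * w ^ (p * -β) * (x (f w) - x a) / f w)) =
      L * L ^ (-β) * p * (x (f w) - x a)
    have e5 : f w * (f w)⁻¹ = 1 := mul_inv_cancel₀ hf0
    generalize w ^ (p * -β) = A at *
    generalize w ^ (p - 1) = B at *
    generalize L ^ (-β) = C at *
    rw [div_eq_mul_inv]
    linear_combination L * C * p * (x (f w) - x a) * (A * B * e5 + e3)
  · have : Continuous fun w : ℝ => w ^ p := Real.continuous_rpow_const hpp.le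
    exact Continuous.continuousOn (by fun_prop)
  · intro w hw
    have h := (Real.hasDerivAt_rpow_const (p := p) (Or.inl hw.1.ne'))
    exact ((h.const_mul L).const_sub (Real.log s)).exp
  · intro w hw
    have := Real.rpow_pos_of_pos hw.1 (p - 1)
    have h2 : 0 < Real.exp (Real.log s - L * w ^ p) * (L * (p * w ^ (p - 1))) := by positivity
    simp only [f']
    linarith

open Set Filter Topology MeasureTheory in
/-- relation between the type 3 and type 2 left Caputo–Hadamard
fractional derivatives of variable order. -/
theorem CHD3_eq_CHD2_add
    (a b : ℝ) (ha : 0 < a) (hab : a < b) (α x : ℝ → ℝ)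
    (hα : ∀ t ∈ Set.Icc a b, α t ∈ Set.Ioo (0 : ℝ) 1)
    (hαd : ∀ t ∈ Set.Icc a b, DifferentiableAt ℝ α t)
    (hx : ContDiff ℝ 1 x)
    (t : ℝ) (ht : t ∈ Set.Ioc a b) :
    CHD3 a α x t
      = CHD2 a α x t
        + (t * deriv α t * digamma (1 - α t) / Real.Gamma (1 - α t)) *
            ∫ τ in a..t, (Real.log (t / τ)) ^ (-(α t)) * (x τ - x a) / τ := by
  have htm : t ∈ Set.Icc a b := ⟨ht.1.le, ht.2⟩
  have hd := hαd t htm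
  obtain ⟨hα0, hα1⟩ := hα t htm
  have ht0 : 0 < t := ha.trans ht.1
  have hF : DifferentiableAt ℝ
      (fun s : ℝ => ∫ τ in a..s, (Real.log (s / τ)) ^ (-(α s)) * (x τ - x a) / τ) t := by
    have hev : (fun s : ℝ => ∫ τ in a..s, (Real.log (s / τ)) ^ (-(α s)) * (x τ - x a) / τ) =ᶠ[𝓝 t]
      fun s => (Real.log s - Real.log a) ^ (1 - α s) * (1 - α s)⁻¹ *
      ∫ w in Ioo (0:ℝ) 1, (x (Real.exp (Real.log s -
        (Real.log s - Real.log a) * w ^ ((1 - α s)⁻¹))) - x a) := by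
      filter_upwards [lt_mem_nhds ht.1, continuousAt_const.eventually_lt hd.continuousAt hα0,
        hd.continuousAt.eventually_lt continuousAt_const hα1] with s h1 h2 h3
      exact aux_subst a s (α s) x ha h1 h2 h3
    refine DifferentiableAt.congr_of_eventuallyEq ?_ hev
    have hlog : DifferentiableAt ℝ Real.log t := Real.differentiableAt_log ht0.ne'
    have hL : DifferentiableAt ℝ (fun s => Real.log s - Real.log a) t := hlog.sub_const _
    have h1α : DifferentiableAt ℝ (fun s => 1 - α s) t := hd.const_sub 1
    have hp : DifferentiableAt ℝ (fun s => (1 - α s)⁻¹) t := h1α.inv (by linarith)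
    refine ((hL.rpow h1α (sub_pos.2 (Real.log_lt_log ha ht.1)).ne').mul hp).mul ?_
    exact aux_diff (fun z => x (Real.exp z) - x a) Real.log (fun s => Real.log s - Real.log a)
      (fun s => (1 - α s)⁻¹) t ((hx.comp Real.contDiff_exp).sub contDiff_const) hlog hL hp
      ((one_lt_inv₀ (by linarith)).2 (by linarith))
  have hG0 : Real.Gamma (1 - α t) ≠ 0 := (Real.Gamma_pos_of_pos (by linarith)).ne'
  have hG : HasDerivAt (fun s => Real.Gamma (1 - α s)) (deriv Real.Gamma (1 - α t) * (-deriv α t)) t := by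
    have h1 : DifferentiableAt ℝ Real.Gamma (1 - α t) := Real.differentiableAt_Gamma (fun m => by
      have : (0:ℝ) ≤ m := m.cast_nonneg
      linarith)
    exact h1.hasDerivAt.comp t (hd.hasDerivAt.const_sub 1)
  have hI := (hG.inv hG0).mul hF.hasDerivAt
  unfold CHD3 CHD2 digamma
  simp only [one_div]
  have := hI.deriv
  simp only [Pi.mul_def, Pi.inv_def] at this
  rw [this]
  field_simp
  ring
end

section
/- Let 0 < a < b, let α : [a,b] → (0,1) be differentiable, and let x : [a,b] → ℝ be continuously differentiable. Then for every t ∈ [a,b), (D₂ᵇx)(t) = (𝔻₁ᵇx)(t) + (t·α'(t)/Γ(2−α(t))) ∫_t^b (ln(τ/t))^{1−α(t)} x'(τ) [1/(1−α(t)) − ln(ln(τ/t))] dτ. -/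
/-- The right Caputo–Hadamard fractional derivative of variable order `α(t)`, type 1. -/
noncomputable def CHD1r (b : ℝ) (α x : ℝ → ℝ) (t : ℝ) : ℝ :=
  (-1 / Real.Gamma (1 - α t)) * ∫ τ in t..b, (Real.log (τ / t)) ^ (-(α t)) * deriv x τ

open Set Filter Topology MeasureTheory

lemma aux_pow {β u v : ℝ} (hβ1 : β < 1) (hv : 0 ≤ v) (huv : v ≤ u) (hu : 0 < u) :
    u ^ β - v ^ β ≤ (u - v) * u ^ (β - 1) := by
  have h1 : v / u ≤ (v / u) ^ β :=
    Real.self_le_rpow_of_le_one (by positivity) ((div_le_one hu).2 huv) hβ1.le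
  rw [Real.div_rpow hv hu.le] at h1
  have h2 : 0 < u ^ β := by positivity
  rw [Real.rpow_sub_one hu.ne']
  have h3 : v * u ^ β / u ≤ v ^ β := by
    have := mul_le_mul_of_nonneg_right h1 h2.le
    rw [div_mul_cancel₀ _ h2.ne'] at this
    calc _ = v / u * u ^ β := by ring
      _ ≤ _ := this
  calc u ^ β - v ^ β ≤ u ^ β - v * u ^ β / u := by linarith
    _ = _ := by field_simp

lemma aux_lip_s8 {β y p q : ℝ} (hβ0 : 0 < β) (hβ1 : β < 1) (hy : y ≠ q) :
    |(max (y - p) 0) ^ β - (max (y - q) 0) ^ β| ≤ |p - q| * |y - q| ^ (β - 1) := by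
  have hz : (0:ℝ) ^ β = 0 := Real.zero_rpow hβ0.ne'
  rcases lt_or_gt_of_ne hy with h | h
  · rw [max_eq_right (by linarith : y - q ≤ 0), hz, sub_zero]
    rcases le_or_gt y p with h' | h'
    · rw [max_eq_right (by linarith : y - p ≤ 0), hz, abs_zero]; positivity
    · rw [max_eq_left (by linarith : 0 ≤ y - p), abs_of_nonneg (Real.rpow_nonneg (by linarith) _),
        abs_of_neg (by linarith : p - q < 0), abs_of_neg (by linarith : y - q < 0)]
      have hd : 0 < -(p - q) := by linarith
      calc (y - p) ^ β ≤ (-(p - q)) ^ β := Real.rpow_le_rpow (by linarith) (by linarith) hβ0.le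
        _ = -(p - q) * (-(p - q)) ^ (β - 1) := by
            rw [Real.rpow_sub_one hd.ne', mul_div_assoc', mul_div_cancel_left₀ _ hd.ne']
        _ ≤ _ := by
            apply mul_le_mul_of_nonneg_left _ hd.le
            exact Real.rpow_le_rpow_of_nonpos (by linarith) (by linarith) (by linarith)
  · rw [max_eq_left (by linarith : 0 ≤ y - q), abs_of_pos (by linarith : 0 < y - q)]
    have hq : 0 < y - q := by linarith
    rcases le_or_gt p q with h' | h'
    · rw [max_eq_left (by linarith : 0 ≤ y - p), abs_of_nonneg (sub_nonneg.2
        (Real.rpow_le_rpow hq.le (by linarith) hβ0.le)), abs_of_nonpos (by linarith : p - q ≤ 0)]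
      refine (aux_pow hβ1 hq.le (by linarith) (by linarith)).trans ?_
      have : y - p - (y - q) = -(p - q) := by ring
      rw [this]
      apply mul_le_mul_of_nonneg_left _ (by linarith)
      exact Real.rpow_le_rpow_of_nonpos (by linarith) (by linarith) (by linarith)
    · have hm : max (y - p) 0 ≤ y - q := max_le (by linarith) hq.le
      rw [abs_sub_comm, abs_of_nonneg (sub_nonneg.2
        (Real.rpow_le_rpow (le_max_right _ _) hm hβ0.le)), abs_of_pos (by linarith : 0 < p - q)]
      refine (aux_pow hβ1 (le_max_right _ _) hm hq).trans ?_
      apply mul_le_mul_of_nonneg_right _ (by positivity)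
      have := le_max_left (y - p) 0
      linarith

lemma aux_loglog {m ξ u M : ℝ} (hm : 0 < m) (hξ : ξ ∈ Icc m 1) (hu : 0 < u) (huM : u ≤ M) :
    |u ^ ξ * Real.log u| ≤ 1 / m + M ^ 2 := by
  obtain ⟨h1, h2⟩ := hξ
  have hpos : 0 < u ^ ξ := by positivity
  rw [abs_mul, abs_of_pos hpos]
  rcases le_or_gt u 1 with h | h
  · have := Real.abs_log_mul_self_rpow_lt u m hu h hm
    rw [abs_mul, abs_of_pos (by positivity : 0 < u ^ m)] at this
    have h3 : u ^ ξ ≤ u ^ m := Real.rpow_le_rpow_of_exponent_ge hu h h1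
    have h4 := mul_le_mul_of_nonneg_right h3 (abs_nonneg (Real.log u))
    nlinarith [sq_nonneg M]
  · have h3 : u ^ ξ ≤ u := by
      simpa using Real.rpow_le_rpow_of_exponent_le h.le h2
    have h4 : |Real.log u| ≤ u := by
      rw [abs_of_pos (Real.log_pos h)]
      linarith [Real.log_le_sub_one_of_pos hu]
    have : 0 < 1 / m := by positivity
    calc _ ≤ u * u := by gcongr
      _ ≤ M ^ 2 := by nlinarith
      _ ≤ _ := by linarith

lemma aux_exp {m β γ u M : ℝ} (hm : 0 < m) (hβ : β ∈ Icc m 1) (hγ : γ ∈ Icc m 1) (hu : 0 ≤ u)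
    (huM : u ≤ M) : |u ^ β - u ^ γ| ≤ (1 / m + M ^ 2) * |β - γ| := by
  rcases hu.eq_or_lt with rfl | hu
  · rw [Real.zero_rpow (by linarith [hβ.1]), Real.zero_rpow (by linarith [hγ.1])]
    simp; positivity
  · have := Convex.norm_image_sub_le_of_norm_hasDerivWithin_le (f := fun x => u ^ x)
      (f' := fun x => u ^ x * Real.log u) (s := Icc m 1) (C := 1 / m + M ^ 2) (x := γ) (y := β)
      (fun x _ => (Real.hasStrictDerivAt_const_rpow hu x).hasDerivAt.hasDerivWithinAt)
      (fun x hx => aux_loglog hm hx hu huM) (convex_Icc _ _) hγ hβ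
    simpa using this

lemma aux_log_lower {x y b : ℝ} (hx : 0 < x) (hxy : x ≤ y) (hy : y ≤ b) :
    (y - x) / b ≤ Real.log y - Real.log x := by
  have hy0 : 0 < y := by linarith
  have h := Real.log_le_sub_one_of_pos (div_pos hx hy0)
  rw [Real.log_div hx.ne' hy0.ne'] at h
  have h2 : (y - x) / b ≤ (y - x) / y := div_le_div_of_nonneg_left (by linarith) hy0 hy
  have h3 : (y - x) / y = 1 - x / y := by field_simp
  linarith

lemma aux_log_upper {x y c : ℝ} (hc : 0 < c) (hx : c ≤ x) (hy : c ≤ y) :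
    |Real.log y - Real.log x| ≤ |y - x| / c := by
  wlog h : x ≤ y generalizing x y with H
  · rw [abs_sub_comm, abs_sub_comm y]
    exact H hy hx (by linarith)
  have hx0 : 0 < x := by linarith
  have hy0 : 0 < y := by linarith
  have h1 := Real.log_le_sub_one_of_pos (div_pos hy0 hx0)
  rw [Real.log_div hy0.ne' hx0.ne'] at h1
  have h2 : (y - x) / x ≤ (y - x) / c := div_le_div_of_nonneg_left (by linarith) hc hx
  have h3 : (y - x) / x = y / x - 1 := by field_simp
  rw [abs_of_nonneg (sub_nonneg.2 (Real.log_le_log hx0 h)), abs_of_nonneg (by linarith)]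
  linarith

lemma aux_int_s8 {c b t r : ℝ} (hc : 0 < c) (hct : c < t) (htb : t < b) (hr : -1 < r) (hr0 : r < 0) :
    IntervalIntegrable (fun τ => |Real.log τ - Real.log t| ^ r) volume c b := by
  have h1 : IntervalIntegrable (fun τ => |τ - t| ^ r) volume c b := by
    have A : IntervalIntegrable (fun τ => (τ - t) ^ r) volume t b := by
      have := (intervalIntegral.intervalIntegrable_rpow' (a := 0) (b := b - t) hr).comp_sub_right t
      simpa using this
    have B : IntervalIntegrable (fun τ => (t - τ) ^ r) volume c t := by
      have := (intervalIntegral.intervalIntegrable_rpow' (a := t - c) (b := 0) hr).comp_sub_left t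
      simpa using this
    have A' : IntervalIntegrable (fun τ => |τ - t| ^ r) volume t b := by
      refine A.congr ?_
      intro τ hτ
      rw [uIoc_of_le htb.le] at hτ
      simp only [abs_of_pos (sub_pos.2 hτ.1)]
    have B' : IntervalIntegrable (fun τ => |τ - t| ^ r) volume c t := by
      refine B.congr ?_
      intro τ hτ
      rw [uIoc_of_le hct.le] at hτ
      simp only [abs_sub_comm τ t, abs_of_nonneg (sub_nonneg.2 hτ.2)]
    exact B'.trans A'
  refine (h1.const_mul (b ^ (-r))).mono_fun' (Measurable.aestronglyMeasurable (by measurability)) ?_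
  filter_upwards [ae_restrict_mem measurableSet_uIoc, 
    ae_restrict_of_ae (Measure.ae_ne volume t)] with τ hτ hne
  rw [uIoc_of_le (by linarith)] at hτ
  have hτ0 : 0 < τ := by linarith [hτ.1]
  have ht0 : 0 < t := by linarith
  have hb : 0 < b := by linarith
  have key : |τ - t| / b ≤ |Real.log τ - Real.log t| := by
    rcases le_total t τ with h | h
    · have := aux_log_lower ht0 h hτ.2
      rw [abs_of_nonneg (by linarith)]
      exact this.trans (le_abs_self _)
    · have := aux_log_lower hτ0 h htb.le
      rw [abs_sub_comm, abs_of_nonneg (by linarith), abs_sub_comm]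
      exact this.trans (le_abs_self _)
  have hp : 0 < |τ - t| / b := div_pos (abs_pos.2 (sub_ne_zero.2 hne)) hb
  rw [Real.norm_of_nonneg (by positivity)]
  refine (Real.rpow_le_rpow_of_nonpos hp key hr0.le).trans (le_of_eq ?_)
  rw [Real.div_rpow (abs_nonneg _) hb.le, Real.rpow_neg hb.le]
  field_simp

lemma hasDerivAt_integral_of_dominated_loc_of_lip_pt {μ : Measure ℝ} {F : ℝ → ℝ → ℝ}
    {F' bound : ℝ → ℝ} {s : Set ℝ} {t : ℝ} (hs : s ∈ 𝓝 t) (hFm : ∀ x, Measurable (F x))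
    (hFi : Integrable (F t) μ) (hF'm : Measurable F')
    (hl : ∀ᵐ a ∂μ, ∀ x ∈ s, ‖F x a - F t a‖ ≤ bound a * ‖x - t‖) (hb : Integrable bound μ)
    (hd : ∀ᵐ a ∂μ, HasDerivAt (fun x => F x a) (F' a) t) :
    Integrable F' μ ∧ HasDerivAt (fun x => ∫ a, F x a ∂μ) (∫ a, F' a ∂μ) t := by
  set L : ℝ →L[ℝ] ℝ →L[ℝ] ℝ := ContinuousLinearMap.toSpanSingletonCLE.toContinuousLinearMap
  have hm : AEStronglyMeasurable (fun a => L (F' a)) μ :=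
    L.continuous.comp_aestronglyMeasurable hF'm.aestronglyMeasurable
  have h := hasFDerivAt_integral_of_dominated_loc_of_lip' hs
    (fun x _ => (hFm x).aestronglyMeasurable) hFi hm hl hb hd
  have hi : Integrable F' μ := by
    have := h.1.apply_continuousLinearMap (1:ℝ)
    simpa [L] using this
  refine ⟨hi, ?_⟩
  have h2 := h.2.hasDerivAt
  rw [ContinuousLinearMap.integral_comp_comm L hi] at h2
  simpa [L] using h2

lemma aux_deriv {c b t β' : ℝ} {β g : ℝ → ℝ} (hc : 0 < c) (hct : c < t) (htb : t < b)
    (hβ : HasDerivAt β β' t) (hβ0 : 0 < β t) (hβ1 : β t < 1) (hg : Continuous g) :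
    IntegrableOn (fun τ => (β' * (Real.log (τ / t) ^ (β t) * Real.log (Real.log (τ / t)))
        - β t * Real.log (τ / t) ^ (β t - 1) / t) * g τ) (Ioc t b) ∧
    HasDerivAt (fun s => ∫ τ in s..b, (Real.log (τ / s)) ^ (β s) * g τ)
      (∫ τ in t..b, (β' * (Real.log (τ / t) ^ (β t) * Real.log (Real.log (τ / t)))
        - β t * Real.log (τ / t) ^ (β t - 1) / t) * g τ) t := by
  have ht0 : 0 < t := by linarith
  set D : ℝ → ℝ := fun τ => (β' * (Real.log (τ / t) ^ (β t) * Real.log (Real.log (τ / t)))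
        - β t * Real.log (τ / t) ^ (β t - 1) / t) * g τ with hD
  set F : ℝ → ℝ → ℝ := fun s τ => (max (Real.log τ - Real.log s) 0) ^ (β s) * g τ with hF
  set F' : ℝ → ℝ := (Ioi t).indicator D with hF'
  have hgm : Measurable g := hg.measurable
  have hFm : ∀ s, Measurable (F s) := fun s => by
    simp only [hF]; measurability
  have hDm : Measurable D := by simp only [hD]; measurability
  have hF'm : Measurable F' := hDm.indicator measurableSet_Ioi
  obtain ⟨K, hK⟩ := hβ.differentiableAt.isBigO_sub.bound
  have hcont := hβ.continuousAt
  set m := β t / 2 with hm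
  have hm0 : 0 < m := by positivity
  set M := Real.log b - Real.log c with hM
  have hnear : ∀ᶠ s in 𝓝 t, s ∈ Ioo c b ∧ β s ∈ Icc m 1 ∧ |β s - β t| ≤ K * |s - t| := by
    filter_upwards [Ioo_mem_nhds hct htb,
      hcont.eventually (Icc_mem_nhds (by linarith : m < β t) hβ1), hK] with s h1 h2 h3
    exact ⟨h1, h2, h3⟩
  obtain ⟨G, hG⟩ := (isCompact_Icc (a := c) (b := b)).exists_bound_of_continuousOn hg.continuousOn
  have hG0 : 0 ≤ G := (norm_nonneg _).trans (hG c ⟨le_rfl, by linarith⟩)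
  set bound : ℝ → ℝ := fun τ => (1 / c * |Real.log τ - Real.log t| ^ (β t - 1)
    + (1 / m + M ^ 2) * K) * G with hbound
  have hboundint : IntegrableOn bound (Ioc c b) := by
    have h1 := aux_int_s8 hc hct htb (r := β t - 1) (by linarith) (by linarith)
    have h2 := ((h1.const_mul (1 / c)).add
      (intervalIntegrable_const (c := (1 / m + M ^ 2) * K))).mul_const G
    exact (intervalIntegrable_iff_integrableOn_Ioc_of_le (by linarith)).1 h2
  have hpos : ∀ s ∈ Ioo c b, ∀ τ ∈ Ioc c b, 0 ≤ max (Real.log τ - Real.log s) 0 ∧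
      max (Real.log τ - Real.log s) 0 ≤ M := by
    intro s hs τ hτ
    refine ⟨le_max_right _ _, max_le ?_ ?_⟩
    · have := Real.log_le_log (by linarith [hτ.1]) hτ.2
      have := Real.log_le_log hc hs.1.le
      linarith
    · exact sub_nonneg.2 (Real.log_le_log hc (by linarith))
  have hFint : IntegrableOn (F t) (Ioc c b) := by
    refine Measure.integrableOn_of_bounded (M := M ^ (β t) * G) (by simp)
      (hFm t).aestronglyMeasurable ?_
    filter_upwards [ae_restrict_mem measurableSet_Ioc] with τ hτ
    obtain ⟨h1, h2⟩ := hpos t ⟨hct, htb⟩ τ hτ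
    rw [norm_mul, Real.norm_of_nonneg (Real.rpow_nonneg h1 _)]
    have := hG τ ⟨hτ.1.le, hτ.2⟩
    have := Real.rpow_le_rpow h1 h2 hβ0.le
    gcongr
    exact Real.rpow_nonneg (h1.trans h2) _
  have hlip : ∀ᵐ τ ∂(volume.restrict (Ioc c b)),
      ∀ s ∈ {s | s ∈ Ioo c b ∧ β s ∈ Icc m 1 ∧ |β s - β t| ≤ K * |s - t|},
        ‖F s τ - F t τ‖ ≤ bound τ * ‖s - t‖ := by
    filter_upwards [ae_restrict_mem measurableSet_Ioc,
      ae_restrict_of_ae (Measure.ae_ne volume t)] with τ hτ hne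
    rintro s ⟨hs, hs2, hs3⟩
    have hτ0 : 0 < τ := by linarith [hτ.1]
    obtain ⟨h1, h2⟩ := hpos s hs τ hτ
    have e1 := aux_exp hm0 hs2 (γ := β t) ⟨by linarith, hβ1.le⟩ h1 h2
    have hne' : Real.log τ ≠ Real.log t := fun h => hne (Real.log_injOn_pos hτ0 ht0 h)
    have e2 := aux_lip_s8 hβ0 hβ1 hne' (p := Real.log s)
    have e3 := aux_log_upper hc hct.le hs.1.le
    have e4 : |max (Real.log τ - Real.log s) 0 ^ (β s) - max (Real.log τ - Real.log t) 0 ^ (β t)|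
        ≤ (1 / c * |Real.log τ - Real.log t| ^ (β t - 1)
          + (1 / m + M ^ 2) * K) * |s - t| := by
      calc _ ≤ _ := abs_sub_le _ (max (Real.log τ - Real.log s) 0 ^ (β t)) _
        _ ≤ (1 / m + M ^ 2) * (K * |s - t|)
            + |s - t| / c * |Real.log τ - Real.log t| ^ (β t - 1) := by
          refine add_le_add (e1.trans ?_) (e2.trans ?_)
          · exact mul_le_mul_of_nonneg_left hs3 (by positivity)
          · exact mul_le_mul_of_nonneg_right e3 (by positivity)
        _ = _ := by ring
    simp only [hF, hbound]
    rw [← sub_mul, norm_mul, Real.norm_eq_abs, Real.norm_eq_abs (s - t)]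
    calc _ ≤ ((1 / c * |Real.log τ - Real.log t| ^ (β t - 1)
          + (1 / m + M ^ 2) * K) * |s - t|) * G :=
        mul_le_mul e4 (hG τ ⟨hτ.1.le, hτ.2⟩) (norm_nonneg _) ((abs_nonneg _).trans e4)
      _ = _ := by ring
  have hdiff : ∀ᵐ τ ∂(volume.restrict (Ioc c b)), HasDerivAt (fun s => F s τ) (F' τ) t := by
    filter_upwards [ae_restrict_mem measurableSet_Ioc,
      ae_restrict_of_ae (Measure.ae_ne volume t)] with τ hτ hne
    have hτ0 : 0 < τ := by linarith [hτ.1]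
    rcases lt_or_gt_of_ne hne with h | h
    · have : F' τ = 0 := indicator_of_notMem (by simp [h.le]) _
      rw [this]
      refine (hasDerivAt_const t (0:ℝ)).congr_of_eventuallyEq ?_
      filter_upwards [Ioi_mem_nhds h, hnear] with s hs hs2
      simp only [hF]
      rw [max_eq_right (sub_nonpos.2 (Real.log_le_log hτ0 (le_of_lt hs))),
        Real.zero_rpow (by linarith [hs2.2.1.1]), zero_mul]
    · have : F' τ = D τ := indicator_of_mem h _
      rw [this]
      have hL : 0 < Real.log τ - Real.log t := sub_pos.2 (Real.log_lt_log ht0 h)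
      have key := (((hasDerivAt_const t (Real.log τ)).sub (Real.hasDerivAt_log ht0.ne')).rpow
        hβ hL).mul_const (g τ)
      refine (key.congr_of_eventuallyEq ?_).congr_deriv ?_
      · filter_upwards [Ioo_mem_nhds hct h] with s hs
        have : 0 ≤ Real.log τ - Real.log s :=
          sub_nonneg.2 (Real.log_le_log (by linarith [hs.1]) hs.2.le)
        simp [hF, max_eq_left this]
      · simp only [hD, Real.log_div hτ0.ne' ht0.ne', Pi.sub_apply]
        field_simp
        ring
  obtain ⟨hI, hder⟩ := hasDerivAt_integral_of_dominated_loc_of_lip_pt hnear hFm hFint hF'm hlip hboundint hdiff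
  have hsets : ∀ s, c < s → Ioc c b ∩ Ioi s = Ioc s b := by
    intro s hs
    ext τ
    simp only [mem_inter_iff, mem_Ioc, mem_Ioi]
    constructor
    · rintro ⟨⟨h1, h2⟩, h3⟩; exact ⟨h3, h2⟩
    · rintro ⟨h1, h2⟩; exact ⟨⟨by linarith, h2⟩, h1⟩
  have hI' : IntegrableOn D (Ioc t b) := by
    have : IntegrableOn F' (Ioc t b) := IntegrableOn.mono_set hI (Ioc_subset_Ioc_left hct.le)
    refine this.congr_fun (fun τ hτ => indicator_of_mem hτ.1 _) measurableSet_Ioc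
  refine ⟨hI', ?_⟩
  have e1 : ∫ τ in Ioc c b, F' τ = ∫ τ in t..b, D τ := by
    rw [hF', setIntegral_indicator measurableSet_Ioi, hsets t hct,
      intervalIntegral.integral_of_le htb.le]
  rw [e1] at hder
  refine hder.congr_of_eventuallyEq ?_
  filter_upwards [hnear] with s hs
  have hs0 : 0 < s := by linarith [hs.1.1]
  rw [intervalIntegral.integral_of_le hs.1.2.le, ← hsets s hs.1.1,
    ← setIntegral_indicator measurableSet_Ioi]
  refine setIntegral_congr_fun measurableSet_Ioc fun τ hτ => ?_
  have hτ0 : 0 < τ := by linarith [hτ.1]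
  simp only [hF]
  by_cases h : s < τ
  · rw [indicator_of_mem (mem_Ioi.2 h), Real.log_div hτ0.ne' hs0.ne',
      max_eq_left (sub_nonneg.2 (Real.log_le_log hs0 h.le))]
  · rw [indicator_of_notMem (by simpa using h),
      max_eq_right (sub_nonpos.2 (Real.log_le_log hτ0 (not_lt.1 h))),
      Real.zero_rpow (by linarith [hs.2.1.1]), zero_mul]

lemma aux_int' {b s γ : ℝ} (hs : 0 < s) (hsb : s < b) (h0 : 0 < γ) (h1 : γ < 1) :
    IntervalIntegrable (fun τ => Real.log (τ / s) ^ (-γ)) volume s b := by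
  have h := aux_int_s8 (c := s / 2) (t := s) (b := b) (r := -γ) (by linarith) (by linarith) hsb
    (by linarith) (by linarith)
  have h' := h.mono_set (c := s) (d := b) (by
    rw [uIcc_of_le hsb.le, uIcc_of_le (by linarith)]
    exact Icc_subset_Icc_left (by linarith))
  refine h'.congr fun τ hτ => ?_
  rw [uIoc_of_le hsb.le] at hτ
  have hτ0 : 0 < τ := by linarith [hτ.1]
  rw [Real.log_div hτ0.ne' hs.ne', abs_of_nonneg (sub_nonneg.2 (Real.log_le_log hs hτ.1.le))]

lemma aux_cont {b s γ : ℝ} (hs : 0 < s) (hsb : s < b) (h0 : 0 < γ) :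
    ContinuousOn (fun τ => Real.log (τ / s) ^ γ) (uIcc s b) := by
  rw [uIcc_of_le hsb.le]
  refine ContinuousOn.rpow_const (ContinuousOn.log (by fun_prop) ?_) fun _ _ => Or.inr h0.le
  intro τ hτ
  have : 0 < τ := by linarith [hτ.1]
  positivity

lemma aux_ibp {b s γ : ℝ} {x : ℝ → ℝ} (hs : 0 < s) (hsb : s < b) (h0 : 0 < γ) (h1 : γ < 1)
    (hx : ContDiff ℝ 1 x) :
    ∫ τ in s..b, Real.log (τ / s) ^ (-γ) * (x τ - x b) / τ
      = -(1 / (1 - γ)) * ∫ τ in s..b, Real.log (τ / s) ^ (1 - γ) * deriv x τ := by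
  have hx' : Continuous (deriv x) := hx.continuous_deriv (by norm_num)
  have hγ : 1 - γ ≠ 0 := by linarith
  have := intervalIntegral.integral_mul_deriv_eq_deriv_mul_of_hasDerivAt (a := s) (b := b)
    (u := fun τ => x τ - x b) (u' := deriv x)
    (v := fun τ => Real.log (τ / s) ^ (1 - γ) * (1 / (1 - γ)))
    (v' := fun τ => Real.log (τ / s) ^ (-γ) * τ⁻¹)
    (by have := hx.continuous; fun_prop)
    ((aux_cont hs hsb (by linarith)).mul continuousOn_const)
    (fun τ _ => ((hx.differentiable (by norm_num)) τ).hasDerivAt.sub_const _)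
    (by
      intro τ hτ
      rw [min_eq_left hsb.le, max_eq_right hsb.le] at hτ
      have hτ0 : 0 < τ := by linarith [hτ.1]
      have hL : 0 < Real.log (τ / s) := Real.log_pos ((one_lt_div hs).2 hτ.1)
      have := ((((hasDerivAt_id τ).div_const s).log (by simp; exact ⟨hτ0.ne', hs.ne'⟩)).rpow_const
        (p := 1 - γ) (Or.inl hL.ne')).mul_const (1 / (1 - γ))
      refine this.congr_deriv ?_
      have e : 1 - γ - 1 = -γ := by ring
      simp only [id, e]
      field_simp)
    (hx'.intervalIntegrable _ _)
    ((aux_int' hs hsb h0 h1).mul_continuousOn (by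
      rw [uIcc_of_le hsb.le]
      exact continuousOn_inv₀.mono fun τ hτ => by
        have : 0 < τ := by linarith [hτ.1]
        exact this.ne'))
  simp only [sub_self, zero_mul, div_self hs.ne', Real.log_one, Real.zero_rpow hγ, mul_zero,
    zero_sub] at this
  rw [← intervalIntegral.integral_const_mul]
  calc _ = ∫ τ in s..b, (x τ - x b) * (Real.log (τ / s) ^ (-γ) * τ⁻¹) := by
        congr 1; ext τ; ring
    _ = _ := by
        rw [this, ← intervalIntegral.integral_neg]
        congr 1; ext τ; ring

/-- relation between the type 2 and type 1 right Caputo–Hadamard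
fractional derivatives of variable order. -/
theorem CHD2r_eq_CHD1r_add
    (a b : ℝ) (ha : 0 < a) (hab : a < b) (α x : ℝ → ℝ)
    (hα : ∀ t ∈ Set.Icc a b, α t ∈ Set.Ioo (0 : ℝ) 1)
    (hαd : ∀ t ∈ Set.Icc a b, DifferentiableAt ℝ α t)
    (hx : ContDiff ℝ 1 x)
    (t : ℝ) (ht : t ∈ Set.Ico a b) :
    CHD2r b α x t
      = CHD1r b α x t
        + (t * deriv α t / Real.Gamma (2 - α t)) *
            ∫ τ in t..b, (Real.log (τ / t)) ^ (1 - α t) * deriv x τ *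
              (1 / (1 - α t) - Real.log (Real.log (τ / t))) := by
  obtain ⟨hta, htb⟩ := ht
  have ht0 : 0 < t := by linarith
  have htI : t ∈ Icc a b := ⟨hta, htb.le⟩
  obtain ⟨h0, h1⟩ := hα t htI
  have hd := (hαd t htI).hasDerivAt
  have hx' : Continuous (deriv x) := hx.continuous_deriv (by norm_num)
  have hxm : Measurable (deriv x) := hx'.measurable
  have hβ : HasDerivAt (fun s => 1 - α s) (-deriv α t) t := hd.const_sub 1
  obtain ⟨-, hG⟩ := aux_deriv (c := t / 2) (by linarith) (by linarith) htb hβ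
    (by linarith) (by linarith) hx'
  have hne : 1 - α t ≠ 0 := by linarith
  have hEq : (fun s : ℝ => ∫ τ in s..b, (Real.log (τ / s)) ^ (-(α s)) * (x τ - x b) / τ)
      =ᶠ[𝓝 t] ((-(fun s => 1 - α s)⁻¹) *
        fun s => ∫ τ in s..b, Real.log (τ / s) ^ (1 - α s) * deriv x τ) := by
    filter_upwards [Ioo_mem_nhds ht0 htb, hd.continuousAt.eventually (Ioo_mem_nhds h0 h1)]
      with s hs hs2
    rw [aux_ibp hs.1 hs.2 hs2.1 hs2.2 hx]
    simp
  have hF := (((hβ.inv hne).neg).mul hG).congr_of_eventuallyEq hEq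
  have i1 : IntervalIntegrable (fun τ => Real.log (τ / t) ^ (-(α t)) * deriv x τ) volume t b :=
    (aux_int' ht0 htb h0 h1).mul_continuousOn hx'.continuousOn
  have i2 : IntervalIntegrable (fun τ => Real.log (τ / t) ^ (1 - α t) * deriv x τ) volume t b :=
    ((aux_cont ht0 htb (by linarith)).mul hx'.continuousOn).intervalIntegrable
  have i3 : IntervalIntegrable (fun τ => Real.log (τ / t) ^ (1 - α t)
      * Real.log (Real.log (τ / t)) * deriv x τ) volume t b := by
    refine IntervalIntegrable.mul_continuousOn ?_ hx'.continuousOn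
    refine (intervalIntegrable_const (c := 1 / (1 - α t) + Real.log (b / t) ^ 2)).mono_fun'
      (Measurable.aestronglyMeasurable (by measurability)) ?_
    filter_upwards [ae_restrict_mem measurableSet_uIoc] with τ hτ
    rw [uIoc_of_le htb.le] at hτ
    have hτ0 : 0 < τ := by linarith [hτ.1]
    exact aux_loglog (by linarith) ⟨le_rfl, by linarith⟩ (Real.log_pos ((one_lt_div ht0).2 hτ.1))
      (Real.log_le_log (by positivity) (by gcongr; exact hτ.2))
  unfold CHD2r CHD1r
  rw [hF.deriv]
  have e1 : ∫ τ in t..b, (-deriv α t * (Real.log (τ / t) ^ (1 - α t)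
        * Real.log (Real.log (τ / t)))
        - (1 - α t) * Real.log (τ / t) ^ (1 - α t - 1) / t) * deriv x τ
      = -deriv α t * (∫ τ in t..b, Real.log (τ / t) ^ (1 - α t)
        * Real.log (Real.log (τ / t)) * deriv x τ)
        - (1 - α t) / t * ∫ τ in t..b, Real.log (τ / t) ^ (-(α t)) * deriv x τ := by
    rw [← intervalIntegral.integral_const_mul, ← intervalIntegral.integral_const_mul,
      ← intervalIntegral.integral_sub (i3.const_mul _) (i1.const_mul _)]
    congr 1; ext τ
    have e : 1 - α t - 1 = -α t := by ring
    rw [e]; ring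
  have e2 : ∫ τ in t..b, (Real.log (τ / t)) ^ (1 - α t) * deriv x τ *
              (1 / (1 - α t) - Real.log (Real.log (τ / t)))
      = 1 / (1 - α t) * (∫ τ in t..b, Real.log (τ / t) ^ (1 - α t) * deriv x τ)
        - ∫ τ in t..b, Real.log (τ / t) ^ (1 - α t)
        * Real.log (Real.log (τ / t)) * deriv x τ := by
    rw [← intervalIntegral.integral_const_mul,
      ← intervalIntegral.integral_sub (i2.const_mul _) i3]
    congr 1; ext τ; ring
  have eΓ : Real.Gamma (2 - α t) = (1 - α t) * Real.Gamma (1 - α t) := by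
    rw [← Real.Gamma_add_one hne]; congr 1; ring
  have hΓ : Real.Gamma (1 - α t) ≠ 0 := (Real.Gamma_pos_of_pos (by linarith)).ne'
  rw [e1, e2, eΓ]
  simp only [Pi.neg_apply, Pi.inv_apply]
  generalize (∫ τ in t..b, Real.log (τ / t) ^ (1 - α t)
        * Real.log (Real.log (τ / t)) * deriv x τ) = I3
  generalize (∫ τ in t..b, Real.log (τ / t) ^ (1 - α t) * deriv x τ) = I2
  generalize (∫ τ in t..b, Real.log (τ / t) ^ (-(α t)) * deriv x τ) = I1
  field_simp
  ring
end

section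
/- Let 0 < a < b, let α : [a,b] → (0,1) be differentiable, and let x : [a,b] → ℝ be continuously differentiable. Then the left Caputo–Hadamard fractional derivative of variable order type 1 of x vanishes at t = a, in the sense that (𝔻₁x)(t) → 0 as t → a⁺. -/
/-- the type 1 left Caputo–Hadamard fractional derivative of
variable order vanishes at `t = a`, in the sense of the right limit. -/
theorem CHD1_tendsto_zero
    (a b : ℝ) (ha : 0 < a) (hab : a < b) (α x : ℝ → ℝ)
    (hα : ∀ t ∈ Set.Icc a b, α t ∈ Set.Ioo (0 : ℝ) 1)
    (hαd : ∀ t ∈ Set.Icc a b, DifferentiableAt ℝ α t)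
    (hx : ContDiff ℝ 1 x) :
    Filter.Tendsto (CHD1 a α x) (nhdsWithin a (Set.Ioi a)) (nhds 0) := by
  have haI : a ∈ Set.Icc a b := ⟨le_rfl, hab.le⟩
  have hb : 0 < b := ha.trans hab
  obtain ⟨h0, h1⟩ := hα a haI
  have hc : ContinuousAt α a := (hαd a haI).continuousAt
  have hG : Filter.Tendsto (fun t => 1 / Real.Gamma (1 - α t)) (nhdsWithin a (Set.Ioi a))
      (nhds (1 / Real.Gamma (1 - α a))) := by
    have hg : ContinuousAt Real.Gamma (1 - α a) := by
      apply DifferentiableAt.continuousAt (𝕜 := ℝ)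
      apply Real.differentiableAt_Gamma
      intro m hm
      have : (0:ℝ) ≤ m := Nat.cast_nonneg m
      linarith
    have h2 : ContinuousAt (fun t => 1 - α t) a := continuousAt_const.sub hc
    have h3 : ContinuousAt (fun t => Real.Gamma (1 - α t)) a :=
      ContinuousAt.comp (f := fun t => 1 - α t) (g := Real.Gamma) hg h2
    have h4 : Real.Gamma (1 - α a) ≠ 0 := (Real.Gamma_pos_of_pos (by linarith)).ne'
    exact ((continuousAt_const.div h3 h4).tendsto).mono_left nhdsWithin_le_nhds
  obtain ⟨β, hβ0, hβ1⟩ := exists_between h1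
  have hdx : Continuous (deriv x) := hx.continuous_deriv le_rfl
  obtain ⟨M, hM⟩ := (isCompact_Icc (a := a) (b := b)).exists_bound_of_continuousOn
    hdx.continuousOn
  have hM0 : 0 ≤ M := (norm_nonneg _).trans (hM a haI)
  have hI : Filter.Tendsto
      (fun t => ∫ τ in a..t, (Real.log (t / τ)) ^ (-(α t)) * deriv x τ)
      (nhdsWithin a (Set.Ioi a)) (nhds 0) := by
    have hlim : Filter.Tendsto (fun t : ℝ => b ^ β * M * ((t - a) ^ (1 - β) / (1 - β)))
        (nhdsWithin a (Set.Ioi a)) (nhds 0) := by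
      have hcc : ContinuousAt (fun t : ℝ => b ^ β * M * ((t - a) ^ (1 - β) / (1 - β))) a := by
        have : ContinuousAt (fun t : ℝ => (t - a) ^ (1 - β)) a :=
          ContinuousAt.rpow_const (by fun_prop) (Or.inr (by linarith))
        exact continuousAt_const.mul (this.div_const _)
      have h5 := hcc.tendsto.mono_left (nhdsWithin_le_nhds (s := Set.Ioi a))
      have h6 : (0:ℝ) ^ (1 - β) = 0 := Real.zero_rpow (by linarith)
      simpa [h6] using h5
    refine squeeze_zero_norm' ?_ hlim
    have hev : ∀ᶠ t in nhdsWithin a (Set.Ioi a), α t < β :=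
      (hc.eventually (gt_mem_nhds hβ0)).filter_mono nhdsWithin_le_nhds
    have hev2 : ∀ᶠ t in nhdsWithin a (Set.Ioi a), t < b :=
      (gt_mem_nhds hab).filter_mono nhdsWithin_le_nhds
    filter_upwards [hev, hev2, self_mem_nhdsWithin] with t ht htb hat
    have hat : a < t := hat
    have ht0 : 0 < t := ha.trans hat
    obtain ⟨p0, p1⟩ := hα t ⟨hat.le, htb.le⟩
    have hint : IntervalIntegrable (fun τ => (t - τ) ^ (-β)) MeasureTheory.volume a t := by
      have h7 : IntervalIntegrable (fun u : ℝ => u ^ (-β)) MeasureTheory.volume (t - a) (t - t) :=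
        intervalIntegral.intervalIntegrable_rpow' (by linarith)
      simpa using h7.comp_sub_left t
    have hval : ∫ τ in a..t, b ^ β * M * (t - τ) ^ (-β)
        = b ^ β * M * ((t - a) ^ (1 - β) / (1 - β)) := by
      rw [intervalIntegral.integral_const_mul,
        intervalIntegral.integral_comp_sub_left (fun u : ℝ => u ^ (-β)) t,
        integral_rpow (Or.inl (by linarith)), sub_self, Real.zero_rpow (by linarith)]
      rw [sub_zero, neg_add_eq_sub]
    rw [← hval]
    refine intervalIntegral.norm_integral_le_of_norm_le hat.le (Filter.Eventually.of_forall ?_)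
      (hint.const_mul _)
    rintro τ ⟨h8, h9⟩
    have hτ0 : 0 < τ := ha.trans h8
    have hd := hM τ ⟨h8.le, h9.trans htb.le⟩
    rcases h9.eq_or_lt with rfl | h9
    · rw [div_self hτ0.ne', Real.log_one, Real.zero_rpow (by linarith), sub_self,
        Real.zero_rpow (by linarith)]
      simp
    have hs0 : 0 < (t - τ) / b := div_pos (by linarith) hb
    have hs1 : (t - τ) / b ≤ 1 := by rw [div_le_one hb]; linarith
    have hl : (t - τ) / b ≤ Real.log (t / τ) := by
      have h10 := Real.one_sub_inv_le_log_of_pos (div_pos ht0 hτ0)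
      have h11 : 1 - (t / τ)⁻¹ = (t - τ) / t := by field_simp
      rw [h11] at h10
      refine le_trans ?_ h10
      exact div_le_div_of_nonneg_left (by linarith) ht0 htb.le
    have hl0 : 0 < Real.log (t / τ) := hs0.trans_le hl
    have e1 : Real.log (t / τ) ^ (-(α t)) ≤ ((t - τ) / b) ^ (-(α t)) :=
      Real.rpow_le_rpow_of_nonpos hs0 hl (by linarith)
    have e2 : ((t - τ) / b) ^ (-(α t)) ≤ ((t - τ) / b) ^ (-β) :=
      Real.rpow_le_rpow_of_exponent_ge hs0 hs1 (by linarith)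
    have e3 : ((t - τ) / b) ^ (-β) = b ^ β * (t - τ) ^ (-β) := by
      rw [Real.div_rpow (by linarith) hb.le, Real.rpow_neg hb.le, div_inv_eq_mul, mul_comm]
    rw [norm_mul, Real.norm_of_nonneg (Real.rpow_nonneg hl0.le _)]
    calc _ ≤ (b ^ β * (t - τ) ^ (-β)) * M :=
          mul_le_mul (e1.trans (e2.trans e3.le)) hd (norm_nonneg _)
            (e3 ▸ Real.rpow_nonneg hs0.le _)
      _ = _ := by ring
  have := hG.mul hI
  rw [mul_zero] at this
  exact this
end

section
/- Let 0 < a < b, n ∈ ℕ with n ≥ 1, let α : [a,b] → (0,1) be a function, and let x : [a,b] → ℝ be of class C^{n+1}. Define recursively x₁(t) = t·x'(t) and x_{k+1}(t) = t·x_k'(t). Then for every t ∈ (a,b], (𝔻₁x)(t) = Σ_{k=1}^{n} (1/Γ(k+1−α(t)))·(ln(t/a))^{k−α(t)}·x_k(a) + (1/Γ(n+1−α(t))) ∫_a^t (ln(t/τ))^{n−α(t)} · x_{n+1}(τ)/τ dτ. -/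
/-- The sequence `x₀ = x`, `x_{k+1}(t) = t ⬝ x_k'(t)`. -/
noncomputable def xseq (x : ℝ → ℝ) : ℕ → ℝ → ℝ
  | 0 => x
  | k + 1 => fun t => t * deriv (xseq x k) t

lemma xseq_contDiff (x : ℝ → ℝ) (k : ℕ) : ∀ m : ℕ, ContDiff ℝ ((m + k : ℕ) : WithTop ℕ∞) x →
    ContDiff ℝ (m : WithTop ℕ∞) (xseq x k) := by
  induction k with
  | zero => intro m h; simpa [xseq] using h
  | succ k ih =>
    intro m h
    have h1 : ContDiff ℝ ((m + 1 : ℕ) : WithTop ℕ∞) (xseq x k) := by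
      apply ih
      rwa [show m + 1 + k = m + (k + 1) by ring]
    have h2 : ContDiff ℝ (m : WithTop ℕ∞) (deriv (xseq x k)) := by
      push_cast at h1
      exact (contDiff_succ_iff_deriv.1 h1).2.2
    exact contDiff_id.mul h2

lemma parts_step (a t s : ℝ) (ha : 0 < a) (hat : a < t) (hs : 0 < s) (y : ℝ → ℝ)
    (hy : ContDiff ℝ 1 y) :
    s * ∫ τ in a..t, (Real.log (t / τ)) ^ (s - 1) * y τ / τ
      = (Real.log (t / a)) ^ s * y a
        + ∫ τ in a..t, (Real.log (t / τ)) ^ s * (τ * deriv y τ) / τ := by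
  have hmem : ∀ τ ∈ Set.Icc a t, τ ≠ 0 := fun τ h => (ha.trans_le h.1).ne'
  have ht0 : t ≠ 0 := (ha.trans hat).ne'
  have hd : ∀ τ ∈ Set.Ioo a t, HasDerivAt (fun τ => -(Real.log (t / τ)) ^ s)
      (s * ((Real.log (t / τ)) ^ (s - 1) / τ)) τ := by
    intro τ h
    have h0 : 0 < τ := ha.trans h.1
    have hq : 0 < t / τ := div_pos (ha.trans hat) h0
    have hl : 0 < Real.log (t / τ) := Real.log_pos ((one_lt_div h0).2 h.2)
    have h1 : HasDerivAt (fun τ : ℝ => t / τ) (-t / τ ^ 2) τ := by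
      have h3 := (hasDerivAt_const τ t).fun_div (hasDerivAt_id' τ) h0.ne'
      refine h3.congr_deriv ?_
      ring
    have h2 := ((h1.log hq.ne').rpow_const (p := s) (Or.inl hl.ne')).neg
    refine h2.congr_deriv ?_
    field_simp
  have hc : ContinuousOn (fun τ => -(Real.log (t / τ)) ^ s) (Set.Icc a t) := by
    apply ContinuousOn.neg
    apply ContinuousOn.rpow_const
    · apply ContinuousOn.log
      · exact continuousOn_const.div continuousOn_id hmem
      · intro τ h; exact div_ne_zero ht0 (hmem τ h)
    · intro τ _; exact Or.inr hs.le
  have hi : IntervalIntegrable (fun τ => s * ((Real.log (t / τ)) ^ (s - 1) / τ))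
      MeasureTheory.volume a t := by
    apply intervalIntegral.intervalIntegrable_deriv_of_nonneg (by rwa [Set.uIcc_of_le hat.le])
    · rw [min_eq_left hat.le, max_eq_right hat.le]; exact hd
    · rw [min_eq_left hat.le, max_eq_right hat.le]
      intro τ h
      have h0 : 0 < τ := ha.trans h.1
      have hl : 0 < Real.log (t / τ) := Real.log_pos ((one_lt_div h0).2 h.2)
      positivity
  have hy' : Continuous (deriv y) := hy.continuous_deriv le_rfl
  have key := intervalIntegral.integral_mul_deriv_eq_deriv_mul_of_hasDerivAt
    (a := a) (b := t) (u := y) (u' := deriv y) hy.continuous.continuousOn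
    (by rwa [Set.uIcc_of_le hat.le])
    (fun τ _ => ((hy.differentiable one_ne_zero) τ).hasDerivAt)
    (by rw [min_eq_left hat.le, max_eq_right hat.le]; exact hd)
    (hy'.intervalIntegrable _ _) hi
  rw [← intervalIntegral.integral_const_mul]
  have e1 : ∫ τ in a..t, s * ((Real.log (t / τ)) ^ (s - 1) * y τ / τ)
      = ∫ τ in a..t, y τ * (s * ((Real.log (t / τ)) ^ (s - 1) / τ)) := by
    congr 1; ext τ; ring
  have e2 : ∫ τ in a..t, (Real.log (t / τ)) ^ s * (τ * deriv y τ) / τ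
      = - ∫ τ in a..t, deriv y τ * -(Real.log (t / τ)) ^ s := by
    rw [← intervalIntegral.integral_neg]
    apply intervalIntegral.integral_congr
    intro τ h
    rw [Set.uIcc_of_le hat.le] at h
    have := hmem τ h
    simp only
    field_simp
  rw [e1, e2, key, div_self ht0, Real.log_one, Real.zero_rpow hs.ne']
  ring

theorem CHD1_integration_by_parts
    (a b : ℝ) (ha : 0 < a) (hab : a < b) (n : ℕ) (hn : 1 ≤ n)
    (α x : ℝ → ℝ)
    (hα : ∀ t ∈ Set.Icc a b, α t ∈ Set.Ioo (0 : ℝ) 1)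
    (hx : ContDiff ℝ (n + 1) x)
    (t : ℝ) (ht : t ∈ Set.Ioc a b) :
    CHD1 a α x t
      = (∑ k ∈ Finset.Icc 1 n,
          (1 / Real.Gamma ((k : ℝ) + 1 - α t)) *
            (Real.log (t / a)) ^ ((k : ℝ) - α t) * xseq x k a)
        + (1 / Real.Gamma ((n : ℝ) + 1 - α t)) *
            ∫ τ in a..t, (Real.log (t / τ)) ^ ((n : ℝ) - α t) * xseq x (n + 1) τ / τ := by
  clear hn
  have hA := hα t ⟨ht.1.le, ht.2⟩
  have hA1 := hA.2
  induction n with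
  | zero =>
    simp only [CHD1, Nat.cast_zero, zero_add, zero_sub]
    rw [Finset.Icc_eq_empty (by norm_num), Finset.sum_empty, zero_add]
    congr 1
    apply intervalIntegral.integral_congr
    intro τ h
    rw [Set.uIcc_of_le ht.1.le] at h
    have : τ ≠ 0 := (ha.trans_le h.1).ne'
    simp only [xseq]
    field_simp
  | succ k ih =>
    rw [ih (hx.of_le (by exact_mod_cast Nat.le_succ _)),
      Finset.sum_Icc_succ_top (by omega), add_assoc]
    congr 1
    have hs : 0 < (k : ℝ) + 1 - α t := by
      have : (0 : ℝ) ≤ k := Nat.cast_nonneg k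
      linarith
    have hy : ContDiff ℝ 1 (xseq x (k + 1)) := by
      have := xseq_contDiff x (k + 1) 1 (by convert hx using 1; push_cast; ring)
      exact_mod_cast this
    have st := parts_step a t _ ha ht.1 hs _ hy
    have hG : Real.Gamma (((k + 1 : ℕ) : ℝ) + 1 - α t)
        = ((k : ℝ) + 1 - α t) * Real.Gamma ((k : ℝ) + 1 - α t) := by
      rw [← Real.Gamma_add_one hs.ne']; congr 1; push_cast; ring
    have hG0 := (Real.Gamma_pos_of_pos hs).ne'
    rw [hG]
    rw [show (k : ℝ) + 1 - α t - 1 = k - α t by ring] at st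
    have st2 : ∫ τ in a..t, (Real.log (t / τ)) ^ ((k : ℝ) - α t) * xseq x (k + 1) τ / τ
      = ((Real.log (t / a)) ^ ((k : ℝ) + 1 - α t) * xseq x (k + 1) a
        + ∫ τ in a..t, (Real.log (t / τ)) ^ ((k : ℝ) + 1 - α t) * xseq x (k + 1 + 1) τ / τ)
          / ((k : ℝ) + 1 - α t) := by
      rw [eq_div_iff hs.ne', mul_comm]; exact st
    rw [st2]
    push_cast
    field_simp
end

section
/- Let n ∈ ℕ with n ≥ 1, let β ∈ (0,1), and let N ∈ ℕ with N ≥ n. Then for every s ∈ [0,1], | Σ_{p=N+1}^{∞} C(n−β, p)·(−1)^p·s^p | ≤ exp((n−β)² + n−β) / (N^{n−β}·(n−β)). -/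
/-- The generalized binomial coefficient `C(s, p) = s (s-1) ⋯ (s-p+1) / p!`. -/
noncomputable def genBinom (s : ℝ) (p : ℕ) : ℝ :=
  (∏ i ∈ Finset.range p, (s - i)) / Nat.factorial p

theorem gb_succ (a : ℝ) (M : ℕ) :
    genBinom a (M + 1) = genBinom (a - 1) M * (a / (M + 1)) := by
  unfold genBinom
  rw [Finset.prod_range_succ', Nat.factorial_succ]
  have h : ∀ i ∈ Finset.range M, a - ((i + 1 : ℕ) : ℝ) = a - 1 - i := by
    intro i _; push_cast; ring
  rw [Finset.prod_congr rfl h]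
  have : (Nat.factorial M : ℝ) ≠ 0 := by positivity
  have : (M : ℝ) + 1 ≠ 0 := by positivity
  push_cast
  field_simp
  ring

theorem gb_step (a : ℝ) (M : ℕ) (h : a ≤ M + 1) :
    |genBinom (a - 1) (M + 1)| = |genBinom (a - 1) M| * (1 - a / (M + 1)) := by
  have h2 : genBinom (a - 1) (M + 1) = genBinom (a - 1) M * (-(1 - a / (M + 1))) := by
    unfold genBinom
    rw [Finset.prod_range_succ, Nat.factorial_succ]
    have : (Nat.factorial M : ℝ) ≠ 0 := by positivity
    have : (M : ℝ) + 1 ≠ 0 := by positivity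
    push_cast
    field_simp
    ring
  have h3 : 0 ≤ 1 - a / (M + 1) := by
    rw [sub_nonneg, div_le_one (by positivity)]; exact h
  rw [h2, abs_mul, abs_neg, abs_of_nonneg h3]

theorem gb_base (a : ℝ) (m : ℕ) (h1 : m < a) (h2 : a ≤ m + 1) :
    |genBinom (a - 1) m| ≤ 1 := by
  unfold genBinom
  rw [abs_div, Nat.abs_cast, div_le_one (by positivity), Finset.abs_prod,
    ← Nat.descFactorial_self, Nat.descFactorial_eq_prod_range]
  push_cast
  apply Finset.prod_le_prod
  · intros; positivity
  · intro i hi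
    have hi : i + 1 ≤ m := Finset.mem_range.1 hi
    rw [Nat.cast_sub (by omega)]
    have : (i : ℝ) + 1 ≤ m := by exact_mod_cast hi
    rw [abs_of_nonneg (by linarith)]
    linarith

theorem gb_bound (a : ℝ) (m : ℕ) (h1 : m < a) (h2 : a ≤ m + 1) (M : ℕ) (hM : m ≤ M) :
    |genBinom (a - 1) M| * ((M : ℝ) + 1) ^ a ≤ ((m : ℝ) + 1) ^ a := by
  have ha : 0 < a := lt_of_le_of_lt (Nat.cast_nonneg m) h1
  induction M, hM using Nat.le_induction with
  | base =>
    exact mul_le_of_le_one_left (by positivity) (gb_base a m h1 h2)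
  | succ M hM ih =>
    refine le_trans ?_ ih
    have hMr : (m : ℝ) ≤ M := by exact_mod_cast hM
    rw [gb_step a M (by linarith), mul_assoc]
    apply mul_le_mul_of_nonneg_left _ (abs_nonneg _)
    have hp : (0 : ℝ) < M + 1 := by positivity
    have e1 : 1 - a / (M + 1) ≤ Real.exp (-(a / (M + 1))) := by
      have := Real.add_one_le_exp (-(a / ((M : ℝ) + 1))); linarith
    have e2 : (((M + 1 : ℕ) : ℝ) + 1) ≤ (M + 1) * Real.exp (1 / (M + 1)) := by
      have := Real.add_one_le_exp (1 / ((M : ℝ) + 1))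
      have := mul_le_mul_of_nonneg_left this hp.le
      have e : ((M : ℝ) + 1) * (1 / (M + 1) + 1) = M + 1 + 1 := by field_simp; ring
      push_cast; linarith
    have e3 : (((M + 1 : ℕ) : ℝ) + 1) ^ a ≤ (M + 1 : ℝ) ^ a * Real.exp (a / (M + 1)) := by
      refine (Real.rpow_le_rpow (by positivity) e2 ha.le).trans_eq ?_
      rw [Real.mul_rpow hp.le (Real.exp_pos _).le, ← Real.exp_mul]
      congr 2; ring
    calc _ ≤ Real.exp (-(a / (M + 1))) * ((M + 1 : ℝ) ^ a * Real.exp (a / (M + 1))) := by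
          gcongr
      _ = _ := by
          rw [Real.exp_neg]; field_simp

/-- bound for the tail of the binomial series of `(1-s)^(n-β)`. -/
theorem abs_tsum_binomial_tail_le
    (n N : ℕ) (hn : 1 ≤ n) (hN : n ≤ N) (β : ℝ) (hβ : β ∈ Set.Ioo (0 : ℝ) 1)
    (s : ℝ) (hs : s ∈ Set.Icc (0 : ℝ) 1) :
    |∑' p : ℕ, genBinom ((n : ℝ) - β) (p + N + 1) * (-1 : ℝ) ^ (p + N + 1) *
        s ^ (p + N + 1)|
      ≤ Real.exp (((n : ℝ) - β) ^ 2 + ((n : ℝ) - β)) /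
          ((N : ℝ) ^ ((n : ℝ) - β) * ((n : ℝ) - β)) := by
  obtain ⟨hb0, hb1⟩ := hβ
  obtain ⟨m, rfl⟩ : ∃ m, n = m + 1 := ⟨n - 1, by omega⟩
  set a : ℝ := ((m + 1 : ℕ) : ℝ) - β with hadef
  have h1 : (m : ℝ) < a := by rw [hadef]; push_cast; linarith
  have h2 : a ≤ m + 1 := by rw [hadef]; push_cast; linarith
  have ha : 0 < a := lt_of_le_of_lt (Nat.cast_nonneg m) h1
  have hNm : (m : ℝ) + 1 ≤ N := by exact_mod_cast hN
  have hterm : ∀ p : ℕ, ‖genBinom a (p + N + 1) * (-1 : ℝ) ^ (p + N + 1) * s ^ (p + N + 1)‖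
      ≤ |genBinom (a - 1) (p + N)| - |genBinom (a - 1) (p + 1 + N)| := by
    intro p
    have hk : a ≤ ((p + N : ℕ) : ℝ) + 1 := by
      push_cast
      have : (0 : ℝ) ≤ p := Nat.cast_nonneg p
      linarith
    rw [show p + 1 + N = p + N + 1 by ring, gb_step a (p + N) hk, gb_succ, Real.norm_eq_abs]
    simp only [abs_mul, abs_pow, abs_neg, abs_one, one_pow, mul_one]
    rw [abs_of_nonneg hs.1, abs_of_nonneg (a := a / _) (by positivity)]
    have : s ^ (p + N + 1) ≤ 1 := pow_le_one₀ hs.1 hs.2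
    refine (mul_le_of_le_one_right (by positivity) this).trans_eq (by ring)
  have hsum : ∀ K : ℕ, ∑ p ∈ Finset.range K,
      ‖genBinom a (p + N + 1) * (-1 : ℝ) ^ (p + N + 1) * s ^ (p + N + 1)‖
      ≤ |genBinom (a - 1) N| := by
    intro K
    refine (Finset.sum_le_sum fun p _ => hterm p).trans ?_
    rw [Finset.sum_range_sub' (fun p => |genBinom (a - 1) (p + N)|)]
    simp
  have hsm := summable_of_sum_range_le (fun _ => norm_nonneg _) hsum
  have key := (norm_tsum_le_tsum_norm hsm).trans
    (Real.tsum_le_of_sum_range_le (fun _ => norm_nonneg _) hsum)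
  rw [Real.norm_eq_abs] at key
  refine key.trans ?_
  have hN0 : (0 : ℝ) < N := by
    have : (0 : ℝ) ≤ m := Nat.cast_nonneg m
    linarith
  rw [le_div_iff₀ (by positivity)]
  have hb := gb_bound a m h1 h2 N (by omega)
  have c1 : (N : ℝ) ^ a ≤ ((N : ℝ) + 1) ^ a :=
    Real.rpow_le_rpow hN0.le (by linarith) ha.le
  have c2 : ((m : ℝ) + 1) ^ a ≤ Real.exp (a ^ 2) := by
    have : (m : ℝ) + 1 ≤ Real.exp a := by
      have := Real.add_one_le_exp a; linarith
    refine (Real.rpow_le_rpow (by positivity) this ha.le).trans_eq ?_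
    rw [← Real.exp_mul, sq]
  have c3 : a ≤ Real.exp a := by
    have := Real.add_one_le_exp a; linarith
  have c4 : |genBinom (a - 1) N| * (N : ℝ) ^ a ≤ Real.exp (a ^ 2) :=
    (mul_le_mul_of_nonneg_left c1 (abs_nonneg _)).trans (hb.trans c2)
  rw [← mul_assoc, Real.exp_add]
  exact mul_le_mul c4 c3 ha.le (Real.exp_pos _).le
end

section
/- Let 0 < a < t and N ∈ ℕ with N ≥ 1. Define E₂(τ) = Σ_{r=N+1}^{∞} (ln(τ/a))^r / (r·(ln(t/a))^r) for τ ∈ [a,t]. Then ∫_a^t E₂(τ) dτ ≤ (2t−a)·ln(t/a)/N. -/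
theorem aux_term_le (a t : ℝ) (ha : 0 < a) (hat : a < t) (m : ℕ) (hm : 1 ≤ m) :
    (∫ τ in a..t, (Real.log (τ / a)) ^ m / ((m : ℝ) * (Real.log (t / a)) ^ m))
      ≤ t * Real.log (t / a) * (1 / (m : ℝ) - 1 / ((m : ℝ) + 1)) := by
  have hL : 0 < Real.log (t / a) := Real.log_pos (by rw [lt_div_iff₀ ha]; linarith)
  set L := Real.log (t / a) with hLdef
  have hm0 : (0 : ℝ) < m := by exact_mod_cast hm
  have hmem : ∀ x ∈ Set.uIcc a t, 0 < x := by
    intro x hx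
    rw [Set.uIcc_of_le hat.le] at hx
    exact lt_of_lt_of_le ha hx.1
  have hlogc : ContinuousOn (fun τ : ℝ => Real.log (τ / a)) (Set.uIcc a t) := by
    apply ContinuousOn.log (by fun_prop)
    intro x hx
    exact (div_pos (hmem x hx) ha).ne'
  have hc1 : ContinuousOn (fun τ : ℝ => (Real.log (τ / a)) ^ m / ((m : ℝ) * L ^ m))
      (Set.uIcc a t) := (hlogc.pow m).div_const _
  have hc2 : ContinuousOn (fun τ : ℝ => t / ((m : ℝ) * L ^ m) * ((Real.log (τ / a)) ^ m * τ⁻¹))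
      (Set.uIcc a t) := by
    apply ContinuousOn.mul continuousOn_const
    apply (hlogc.pow m).mul
    exact continuousOn_id.inv₀ (fun x hx => (hmem x hx).ne')
  have h1 : (∫ τ in a..t, (Real.log (τ / a)) ^ m / ((m : ℝ) * L ^ m))
      ≤ ∫ τ in a..t, t / ((m : ℝ) * L ^ m) * ((Real.log (τ / a)) ^ m * τ⁻¹) := by
    apply intervalIntegral.integral_mono_on hat.le hc1.intervalIntegrable hc2.intervalIntegrable
    intro x hx
    have hx0 : 0 < x := lt_of_lt_of_le ha hx.1
    have hl : 0 ≤ Real.log (x / a) := Real.log_nonneg (by rw [le_div_iff₀ ha]; linarith [hx.1])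
    have h2 : 1 ≤ t * x⁻¹ := by
      rw [← div_eq_mul_inv, le_div_iff₀ hx0]; linarith [hx.2]
    have h3 : 0 ≤ (Real.log (x / a)) ^ m / ((m : ℝ) * L ^ m) := by positivity
    calc _ ≤ (Real.log (x / a)) ^ m / ((m : ℝ) * L ^ m) * (t * x⁻¹) := le_mul_of_one_le_right h3 h2
      _ = _ := by ring
  have h4 : (∫ τ in a..t, t / ((m : ℝ) * L ^ m) * ((Real.log (τ / a)) ^ m * τ⁻¹))
      = t / ((m : ℝ) * L ^ m) * ((Real.log (t / a)) ^ (m + 1) / ((m : ℝ) + 1))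
        - t / ((m : ℝ) * L ^ m) * ((Real.log (a / a)) ^ (m + 1) / ((m : ℝ) + 1)) := by
    apply intervalIntegral.integral_eq_sub_of_hasDerivAt
      (f := fun τ => t / ((m : ℝ) * L ^ m) * ((Real.log (τ / a)) ^ (m + 1) / ((m : ℝ) + 1)))
      _ hc2.intervalIntegrable
    intro x hx
    have hx0 := hmem x hx
    have hd : HasDerivAt (fun τ : ℝ => Real.log (τ / a)) (1 / a / (x / a)) x :=
      ((hasDerivAt_id x).div_const a).log (div_pos hx0 ha).ne'
    have := ((hd.pow (m + 1)).div_const ((m : ℝ) + 1)).const_mul (t / ((m : ℝ) * L ^ m))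
    have hm1 : (m : ℝ) + 1 ≠ 0 := by positivity
    refine HasDerivAt.congr_deriv this ?_
    rw [Nat.add_sub_cancel]
    push_cast
    field_simp
  refine h1.trans (le_of_eq ?_)
  rw [h4, div_self ha.ne', Real.log_one, ← hLdef]
  have : (m : ℝ) + 1 ≠ 0 := by positivity
  rw [zero_pow (by omega)]
  field_simp
  ring

/-- integral bound for the tail `E₂` of the logarithmic series. -/
theorem integral_log_series_tail_le
    (a t : ℝ) (ha : 0 < a) (hat : a < t) (N : ℕ) (hN : 1 ≤ N) :
    (∫ τ in a..t, ∑' r : ℕ,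
        (Real.log (τ / a)) ^ (r + N + 1) /
          (((r : ℝ) + N + 1) * (Real.log (t / a)) ^ (r + N + 1)))
      ≤ (2 * t - a) * Real.log (t / a) / N := by
  have hL : 0 < Real.log (t / a) := Real.log_pos (by rw [lt_div_iff₀ ha]; linarith)
  have ht : 0 < t := ha.trans hat
  have hN0 : (0 : ℝ) < N := by exact_mod_cast hN
  set F : ℕ → ℝ → ℝ := fun r τ => (Real.log (τ / a)) ^ (r + N + 1) /
          (((r : ℝ) + N + 1) * (Real.log (t / a)) ^ (r + N + 1)) with hF
  have hFc : ∀ r, IntervalIntegrable (F r) MeasureTheory.volume a t := by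
    intro r
    apply ContinuousOn.intervalIntegrable
    apply ContinuousOn.div_const
    apply ContinuousOn.pow
    apply ContinuousOn.log (by fun_prop)
    intro x hx
    rw [Set.uIcc_of_le hat.le] at hx
    exact (div_pos (lt_of_lt_of_le ha hx.1) ha).ne'
  have hFn : ∀ r, ∀ x ∈ Set.Icc a t, 0 ≤ F r x := by
    intro r x hx
    have hl : 0 ≤ Real.log (x / a) := Real.log_nonneg (by rw [le_div_iff₀ ha]; linarith [hx.1])
    simp only [hF]
    positivity
  have hI0 : ∀ r, 0 ≤ ∫ τ in a..t, F r τ := fun r =>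
    intervalIntegral.integral_nonneg hat.le (hFn r)
  have hI : ∀ r : ℕ, (∫ τ in a..t, F r τ) ≤ t * Real.log (t / a) *
      (1 / ((r : ℝ) + N + 1) - 1 / ((r : ℝ) + N + 1 + 1)) := by
    intro r
    have := aux_term_le a t ha hat (r + N + 1) (by omega)
    push_cast at this
    exact this
  have hps : ∀ n : ℕ, ∑ r ∈ Finset.range n, (∫ τ in a..t, F r τ) ≤ t * Real.log (t / a) *
      (1 / ((N : ℝ) + 1) - 1 / ((n : ℝ) + N + 1)) := by
    intro n
    induction n with
    | zero => simp
    | succ k ih =>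
      rw [Finset.sum_range_succ]
      have := hI k
      have e : ((k + 1 : ℕ) : ℝ) + N + 1 = (k : ℝ) + N + 1 + 1 := by push_cast; ring
      rw [e]
      linarith
  have hps' : ∀ n : ℕ, ∑ r ∈ Finset.range n, (∫ τ in a..t, F r τ) ≤
      (2 * t - a) * Real.log (t / a) / N := by
    intro n
    refine (hps n).trans ?_
    have h1 : (1 / ((N : ℝ) + 1) - 1 / ((n : ℝ) + N + 1)) ≤ 1 / N := by
      have : 1 / ((N : ℝ) + 1) ≤ 1 / N := one_div_le_one_div_of_le hN0 (by linarith)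
      have : 0 ≤ 1 / ((n : ℝ) + N + 1) := by positivity
      linarith
    calc _ ≤ t * Real.log (t / a) * (1 / N) := by gcongr
      _ ≤ (2 * t - a) * Real.log (t / a) * (1 / N) := by gcongr; linarith
      _ = _ := by ring
  have hsum : Summable (fun r => ∫ τ in a..t, F r τ) := summable_of_sum_range_le hI0 hps'
  have key := MeasureTheory.hasSum_integral_of_summable_integral_norm
    (μ := MeasureTheory.volume.restrict (Set.Ioc a t)) (F := F)
    (fun r => (intervalIntegrable_iff_integrableOn_Ioc_of_le hat.le).1 (hFc r))
    (by
      convert hsum using 2 with r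
      rw [intervalIntegral.integral_of_le hat.le]
      apply MeasureTheory.setIntegral_congr_fun measurableSet_Ioc
      intro x hx
      exact Real.norm_of_nonneg (hFn r x ⟨hx.1.le, hx.2⟩))
  rw [intervalIntegral.integral_of_le hat.le]
  rw [← key.tsum_eq]
  simp only [← intervalIntegral.integral_of_le hat.le]
  exact Real.tsum_le_of_sum_range_le hI0 hps'
end
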